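/- arXiv:1302.5651 — 2 statements merged into one kernel-verified Lean document; each statement's English description precedes it below -/
import Mathlib

section
/- Let X be a strongly locally homogeneous completely metrizable space and let K be a tame family of compact subsets of X such that each K ∈ K contains more than one point and has nonempty interior in X. Then: (1) each nowhere dense subset of X lies in a K-spongy subset of X; (2) any two K-spongy subsets of X are ambiently homeomorphic; and (3) any K-spongy subset of X is a universal nowhere dense subset of X. -/
open Set Topology unitInterval

noncomputable section

/-! ### General notions -/

/-- `X` is completely metrizable: its topology is generated by a complete metric. -/
def CompletelyMetrizable (X : Type*) [t : TopologicalSpace X] : Prop :=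
  ∃ m : MetricSpace X, m.toUniformSpace.toTopologicalSpace = t ∧
    @CompleteSpace X m.toUniformSpace

/-- The model cube `I^n` for `n ≤ ω`: `some k` codes the finite cube `I^k`,
`none` codes the Hilbert cube `I^ω`. -/
def ModelCube : Option ℕ → Type
  | some k => Fin k → unitInterval
  | none => ℕ → unitInterval

instance : (n : Option ℕ) → TopologicalSpace (ModelCube n)
  | some k => inferInstanceAs (TopologicalSpace (Fin k → unitInterval))
  | none => inferInstanceAs (TopologicalSpace (ℕ → unitInterval))

/-- A manifold modeled on `E`: a paracompact space each point of which has an open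
neighborhood homeomorphic to an open subset of `E`. -/
def IsManifoldModeledOn (M : Type*) [TopologicalSpace M] (E : Type*) [TopologicalSpace E] :
    Prop :=
  ParacompactSpace M ∧
    ∀ x : M, ∃ O : Set M, IsOpen O ∧ x ∈ O ∧ ∃ U : Set E, IsOpen U ∧ Nonempty (↥O ≃ₜ ↥U)

/-- The pair `(X, A)` is homeomorphic to the pair `(Y, B)`. -/
def PairHomeo {X Y : Type*} [TopologicalSpace X] [TopologicalSpace Y]
    (A : Set X) (B : Set Y) : Prop :=
  ∃ e : X ≃ₜ Y, ⇑e '' A = B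

/-- The cube `I^n` sitting inside `ℝ^n`. -/
def stdCube (n : ℕ) : Set (Fin n → ℝ) := {f | ∀ i, f i ∈ Icc (0 : ℝ) 1}

/-- The copy of `I^ω × [0,1]` sitting inside `I^ω × [0,2)`. -/
def hilbertCollar : Set ((ℕ → unitInterval) × ↥(Ico (0 : ℝ) 2)) := {p | (p.2 : ℝ) ≤ 1}

/-- The Hilbert cube `I^ω`. -/
abbrev HilbertCube : Type := ℕ → unitInterval

/-- The space `I^ω × [0,1)`. -/
abbrev HilbertHalfOpen : Type := HilbertCube × ↥(Ico (0 : ℝ) 1)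

/-- `B` is a tame ball in the `I^n`-manifold `M`: it has an open neighborhood `O` such
that the pair `(O, B)` is homeomorphic to `(ℝ^n, I^n)` (for finite `n`), resp. to
`(I^ω × [0,2), I^ω × [0,1])` (for `n = ω`). -/
def IsTameBall (n : Option ℕ) {M : Type*} [TopologicalSpace M] (B : Set M) : Prop :=
  ∃ O : Set M, IsOpen O ∧ B ⊆ O ∧
    match n with
    | some k => PairHomeo {x : ↥O | (x : M) ∈ B} (stdCube k)
    | none => PairHomeo {x : ↥O | (x : M) ∈ B} hilbertCollar

/-- The family of all tame balls of the `I^n`-manifold `X`. -/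
def tameBalls (n : Option ℕ) (X : Type*) [TopologicalSpace X] : Set (Set X) :=
  {B | IsTameBall n B}

/-- A family of subsets of `X` is vanishing if for any open cover `𝒰` of `X` the subfamily
of sets contained in no member of `𝒰` is locally finite in `X`. -/
def VanishingFamily {X : Type*} [TopologicalSpace X] (F : Set (Set X)) : Prop :=
  ∀ 𝒰 : Set (Set X), (∀ u ∈ 𝒰, IsOpen u) → ⋃₀ 𝒰 = univ →
    LocallyFinite (fun A : {A : Set X // A ∈ F ∧ ∀ u ∈ 𝒰, ¬ A ⊆ u} => (A : Set X))

/-- The family of connected components of the complement of `S`. -/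
def complComponents {X : Type*} [TopologicalSpace X] (S : Set X) : Set (Set X) :=
  {C | ∃ x ∈ Sᶜ, C = connectedComponentIn Sᶜ x}

/-- A spongy subset of an `I^n`-manifold. -/
def IsSpongy (n : Option ℕ) {M : Type*} [TopologicalSpace M] (S : Set M) : Prop :=
  IsClosed S ∧ IsNowhereDense S ∧
  VanishingFamily (complComponents S) ∧
  (∀ C ∈ complComponents S, ∀ C' ∈ complComponents S, C ≠ C' →
    closure C ∩ closure C' = ∅) ∧
  ∀ C ∈ complComponents S, IsTameBall n (closure C)

/-- `S` is a universal nowhere dense subset of `M`. -/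
def UniversalNowhereDense {M : Type*} [TopologicalSpace M] (S : Set M) : Prop :=
  IsNowhereDense S ∧ ∀ A : Set M, IsNowhereDense A → ∃ h : M ≃ₜ M, ⇑h '' A ⊆ S

/-- `(f, g) ≺ 𝒜` : for each `z` with `f z ≠ g z` the doubleton `{f z, g z}` lies in some
member of `𝒜`. -/
def Near {Z X : Type*} (f g : Z → X) (𝒜 : Set (Set X)) : Prop :=
  ∀ z : Z, f z ≠ g z → ∃ A ∈ 𝒜, f z ∈ A ∧ g z ∈ A

/-- The star `St(A, 𝒰)` of a set `A` with respect to a family `𝒰`. -/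
def covStar {X : Type*} (A : Set X) (𝒰 : Set (Set X)) : Set X :=
  ⋃₀ {u ∈ 𝒰 | (u ∩ A).Nonempty}

/-- A compact set `K ⊆ X` is locally shrinkable if for each open neighborhood `O` of `K`
and each open cover `𝒱` of `O` there is a homeomorphism of `X` supported in `O` moving `K`
into a member of `𝒱`. -/
def LocallyShrinkable {X : Type*} [TopologicalSpace X] (K : Set X) : Prop :=
  ∀ O : Set X, IsOpen O → K ⊆ O →
    ∀ 𝒱 : Set (Set X), (∀ v ∈ 𝒱, IsOpen v ∧ v ⊆ O) → O ⊆ ⋃₀ 𝒱 →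
      ∃ h : X ≃ₜ X, (∀ x ∉ O, h x = x) ∧ ∃ v ∈ 𝒱, ⇑h '' K ⊆ v

/-- A family of sets is ambiently invariant if it is invariant under images of
homeomorphisms of the ambient space. -/
def AmbientlyInvariant {X : Type*} [TopologicalSpace X] (𝒦 : Set (Set X)) : Prop :=
  ∀ h : X ≃ₜ X, ∀ K ∈ 𝒦, ⇑h '' K ∈ 𝒦

/-- The local shift property of a family of sets. -/
def LocalShiftProperty {X : Type*} [TopologicalSpace X] (𝒦 : Set (Set X)) : Prop :=
  ∀ x : X, ∀ O ∈ 𝓝 x, ∃ U ∈ 𝓝 x, U ⊆ O ∧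
    ∀ A ∈ 𝒦, ∀ B ∈ 𝒦, A ⊆ U → B ⊆ U →
      ∃ h : X ≃ₜ X, ⇑h '' A = B ∧ ∀ y ∉ O, h y = y

/-- A tame family of compact subsets of `X`. -/
def IsTameFamily {X : Type*} [TopologicalSpace X] (𝒦 : Set (Set X)) : Prop :=
  (∀ K ∈ 𝒦, IsCompact K) ∧ AmbientlyInvariant 𝒦 ∧ (∀ K ∈ 𝒦, LocallyShrinkable K) ∧
    LocalShiftProperty 𝒦 ∧ ∀ U : Set X, IsOpen U → U.Nonempty → ∃ K ∈ 𝒦, K ⊆ U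

/-- `X` is strongly locally homogeneous. -/
def StronglyLocallyHomogeneous (X : Type*) [TopologicalSpace X] : Prop :=
  ∀ x : X, ∀ O ∈ 𝓝 x, ∃ U ∈ 𝓝 x, U ⊆ O ∧
    ∀ y ∈ U, ∃ h : X ≃ₜ X, h x = y ∧ ∀ z ∉ O, h z = z

/-- `X` is topologically homogeneous. -/
def TopologicallyHomogeneous (X : Type*) [TopologicalSpace X] : Prop :=
  ∀ x y : X, ∃ h : X ≃ₜ X, h x = y

/-- `A` is σ-discrete in `X`: a countable union of closed discrete subsets of `X`. -/
def SigmaDiscrete {X : Type*} [TopologicalSpace X] (A : Set X) : Prop :=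
  ∃ f : ℕ → Set X, A = ⋃ n, f n ∧ ∀ n, IsClosed (f n) ∧ DiscreteTopology ↥(f n)

/-! ### Decompositions -/

/-- A decomposition of a topological space `X`: a cover of `X` by pairwise disjoint
nonempty compact subsets. -/
structure Decomposition (X : Type*) [TopologicalSpace X] where
  pieces : Set (Set X)
  nonempty' : ∀ A ∈ pieces, A.Nonempty
  isCompact' : ∀ A ∈ pieces, IsCompact A
  disjoint' : ∀ A ∈ pieces, ∀ B ∈ pieces, A ≠ B → Disjoint A B
  covers : ∀ x : X, ∃ A ∈ pieces, x ∈ A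

namespace Decomposition

variable {X : Type*} [TopologicalSpace X] (D : Decomposition X)

/-- The decomposition space `X/D` (as a set it is the set of pieces). -/
def Space : Type _ := {A : Set X // A ∈ D.pieces}

/-- The quotient map `q_D : X → X/D`. -/
noncomputable def q (x : X) : D.Space := ⟨(D.covers x).choose, (D.covers x).choose_spec.1⟩

/-- The quotient topology on the decomposition space. -/
instance : TopologicalSpace D.Space := TopologicalSpace.coinduced D.q inferInstance

/-- The non-degeneracy part `D°` of a decomposition, viewed inside the decomposition
space. -/
def nondeg : Set D.Space := {A | ¬ (A.1 : Set X).Subsingleton}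

/-- The union of the non-degenerate pieces of a decomposition. -/
def nondegUnion : Set X := ⋃₀ {A ∈ D.pieces | ¬ A.Subsingleton}

/-- A `D`-saturated subset of `X`. -/
def Saturated (U : Set X) : Prop := ∀ A ∈ D.pieces, (A ∩ U).Nonempty → A ⊆ U

/-- A decomposition is upper semicontinuous if saturations of closed sets are closed. -/
def IsUSC : Prop :=
  ∀ F : Set X, IsClosed F → IsClosed (⋃₀ {A ∈ D.pieces | (A ∩ F).Nonempty})

/-- A decomposition is vanishing if for every open cover `𝒰` of `X` the family of pieces
contained in no member of `𝒰` is discrete in `X`. -/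
def Vanishing : Prop :=
  ∀ 𝒰 : Set (Set X), (∀ u ∈ 𝒰, IsOpen u) → ⋃₀ 𝒰 = univ →
    ∀ x : X, ∃ V ∈ 𝓝 x, ∀ A ∈ D.pieces, (∀ u ∈ 𝒰, ¬ A ⊆ u) →
      ∀ B ∈ D.pieces, (∀ u ∈ 𝒰, ¬ B ⊆ u) →
        (V ∩ A).Nonempty → (V ∩ B).Nonempty → A = B

/-- The restriction of `D` to a (`D`-saturated open) set `U` is shrinkable: for each
`D`-saturated open cover `𝒰` of `U` and each open cover `𝒱` of `U` there is a
homeomorphism `h` of the subspace `U` with `(h, id) ≺ 𝒰` and `{h(A) : A ∈ D, A ⊆ U} ≺ 𝒱`. -/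
def ShrinkableOn (U : Set X) : Prop :=
  ∀ 𝒰 : Set (Set X),
    (∀ u ∈ 𝒰, IsOpen u ∧ u ⊆ U ∧ ∀ A ∈ D.pieces, A ⊆ U → (A ∩ u).Nonempty → A ⊆ u) →
    U ⊆ ⋃₀ 𝒰 →
    ∀ 𝒱 : Set (Set X), (∀ v ∈ 𝒱, IsOpen v ∧ v ⊆ U) → U ⊆ ⋃₀ 𝒱 →
      ∃ h : ↥U ≃ₜ ↥U,
        Near (fun x : ↥U => (h x : X)) (fun x : ↥U => (x : X)) 𝒰 ∧
        ∀ A ∈ D.pieces, A ⊆ U →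
          ∃ v ∈ 𝒱, (fun x : ↥U => (x : X)) '' (⇑h '' {x : ↥U | (x : X) ∈ A}) ⊆ v

/-- A decomposition is strongly shrinkable if its restriction to any `D`-saturated open
set is shrinkable. -/
def StronglyShrinkable : Prop :=
  ∀ U : Set X, IsOpen U → D.Saturated U → D.ShrinkableOn U

/-- A decomposition is `𝒦`-tame if it is vanishing, strongly shrinkable, and all its
non-degenerate pieces belong to `𝒦`. -/
def KTame (𝒦 : Set (Set X)) : Prop :=
  D.Vanishing ∧ D.StronglyShrinkable ∧ ∀ A ∈ D.pieces, ¬ A.Subsingleton → A ∈ 𝒦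

/-- A decomposition is dense if its non-degeneracy part is dense in the decomposition
space. -/
def IsDenseDecomp : Prop := Dense D.nondeg

/-- A decomposition is discrete if its non-degeneracy part is closed and discrete in
the decomposition space. -/
def IsDiscreteDecomp : Prop := IsClosed D.nondeg ∧ DiscreteTopology ↥D.nondeg

end Decomposition

/-- A homeomorphism `φ : X/A → X/B` is `(A,B)`-liftable if it lifts to a homeomorphism
`Φ : X → X` with `q_B ∘ Φ = φ ∘ q_A`. -/
def Liftable {X : Type*} [TopologicalSpace X] (A B : Decomposition X)
    (φ : A.Space ≃ₜ B.Space) : Prop :=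
  ∃ Φ : X ≃ₜ X, ∀ x : X, B.q (Φ x) = φ (A.q x)

/-- Two decompositions of `X` are topologically equivalent if some homeomorphism of `X`
maps the first family of pieces onto the second. -/
def TopEquivDecomp {X : Type*} [TopologicalSpace X] (A B : Decomposition X) : Prop :=
  ∃ Φ : X ≃ₜ X, (fun S : Set X => ⇑Φ '' S) '' A.pieces = B.pieces

/-- A `𝒦`-spongy subset of `X`. -/
def IsKSpongy {X : Type*} [TopologicalSpace X] (𝒦 : Set (Set X)) (S : Set X) : Prop :=
  ∃ D : Decomposition X, D.KTame 𝒦 ∧ D.IsDenseDecomp ∧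
    Sᶜ = ⋃ A ∈ D.pieces, interior A

/-! ### Shape notions -/

/-- `K` is point-like in `X`. -/
def PointLike {X : Type*} [TopologicalSpace X] (K : Set X) : Prop :=
  ∀ N : Set X, IsClosed N → K ⊆ interior N →
    ∃ x ∈ interior N, Nonempty (↥(N \ K) ≃ₜ ↥(N \ {x}))

/-- `K` is contractible in `U`: the inclusion `K ↪ U` is homotopic to a constant map. -/
def ContractibleIn {X : Type*} [TopologicalSpace X] (K U : Set X) : Prop :=
  ∃ hKU : K ⊆ U, ∃ y : ↥U,
    (ContinuousMap.mk (Set.inclusion hKU) (continuous_inclusion hKU)).Homotopic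
      (ContinuousMap.const ↥K y)

/-- `K` is cell-like in `X`: `K` is contractible in each of its neighborhoods. -/
def CellLike {X : Type*} [TopologicalSpace X] (K : Set X) : Prop :=
  ∀ U : Set X, IsOpen U → K ⊆ U → ContractibleIn K U

/-- `K` is cellular (with model `E`): every neighborhood of `K` contains a neighborhood
of `K` homeomorphic to `E`. -/
def CellularIn (E : Type*) [TopologicalSpace E] {X : Type*} [TopologicalSpace X]
    (K : Set X) : Prop :=
  ∀ U : Set X, IsOpen U → K ⊆ U → ∃ V ∈ 𝓝ˢ K, V ⊆ U ∧ Nonempty (↥V ≃ₜ E)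

/-- `X` is locally contractible. -/
def LocallyContractible (X : Type*) [TopologicalSpace X] : Prop :=
  ∀ x : X, ∀ U ∈ 𝓝 x, ∃ V ∈ 𝓝 x, V ⊆ U ∧ ContractibleIn V U


/-! ### Locally discrete families and vanishing decompositions -/

/-- Around each point of `U`, only the members of `𝒜` through that point are met. -/
def DiscreteOn {X : Type*} [TopologicalSpace X] (U : Set X) (𝒜 : Set (Set X)) : Prop :=
  ∀ x ∈ U, ∃ V ∈ 𝓝 x, ∀ A ∈ 𝒜, (A ∩ V).Nonempty → x ∈ A

lemma DiscreteOn.mono {X : Type*} [TopologicalSpace X] {U : Set X} {𝒜 ℬ : Set (Set X)}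
    (h : DiscreteOn U 𝒜) (hs : ℬ ⊆ 𝒜) : DiscreteOn U ℬ := fun x hx ↦
  let ⟨V, hV, hA⟩ := h x hx
  ⟨V, hV, fun A hA' ↦ hA A (hs hA')⟩

lemma DiscreteOn.union {X : Type*} [TopologicalSpace X] {U : Set X} {𝒜 ℬ : Set (Set X)}
    (h : DiscreteOn U 𝒜) (h' : DiscreteOn U ℬ) : DiscreteOn U (𝒜 ∪ ℬ) := by
  intro x hx
  obtain ⟨V, hV, hA⟩ := h x hx
  obtain ⟨V', hV', hA'⟩ := h' x hx
  refine ⟨V ∩ V', Filter.inter_mem hV hV', ?_⟩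
  rintro A (hm | hm) hne
  · exact hA A hm (hne.mono (by gcongr; exact inter_subset_left))
  · exact hA' A hm (hne.mono (by gcongr; exact inter_subset_right))

lemma DiscreteOn.isClosed_sUnion {X : Type*} [TopologicalSpace X] {𝒜 : Set (Set X)}
    (h : DiscreteOn univ 𝒜) : IsClosed (⋃₀ 𝒜) := by
  rw [← isOpen_compl_iff, isOpen_iff_mem_nhds]
  intro x hx
  obtain ⟨V, hV, hA⟩ := h x (mem_univ x)
  filter_upwards [hV] with y hy
  rintro ⟨A, hAm, hyA⟩
  exact hx ⟨A, hAm, hA A hAm ⟨y, hyA, hy⟩⟩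

lemma DiscreteOn.image_homeomorph {X : Type*} [TopologicalSpace X] {𝒜 : Set (Set X)}
    (h : DiscreteOn univ 𝒜) (Φ : X ≃ₜ X) : DiscreteOn univ ((fun K ↦ ⇑Φ '' K) '' 𝒜) := by
  intro x _
  obtain ⟨V, hV, hA⟩ := h (Φ.symm x) (mem_univ _)
  refine ⟨Φ.symm ⁻¹' V, Φ.symm.continuous.continuousAt hV, ?_⟩
  rintro _ ⟨A, hAm, rfl⟩ ⟨_, ⟨y, hy, rfl⟩, hyV⟩
  exact ⟨_, hA A hAm ⟨y, hy, by simpa using hyV⟩, by simp⟩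

namespace Decomposition

lemma eq_of_mem {X : Type*} [TopologicalSpace X] (D : Decomposition X) {A B : Set X}
    (hA : A ∈ D.pieces) (hB : B ∈ D.pieces) {x : X} (hxA : x ∈ A) (hxB : x ∈ B) : A = B := by
  by_contra hne
  exact (D.disjoint' A hA B hB hne).le_bot ⟨hxA, hxB⟩

lemma mem_q {X : Type*} [TopologicalSpace X] (D : Decomposition X) (x : X) :
    x ∈ (D.q x).1 := (D.covers x).choose_spec.2

lemma saturated_sUnion {X : Type*} [TopologicalSpace X] (D : Decomposition X)
    {P : Set (Set X)} (hP : P ⊆ D.pieces) : D.Saturated (⋃₀ P) := by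
  rintro A hA ⟨x, hxA, B, hB, hxB⟩
  rw [D.eq_of_mem hA (hP hB) hxA hxB]
  exact subset_sUnion_of_mem hB

lemma Saturated.compl {X : Type*} [TopologicalSpace X] {D : Decomposition X} {M : Set X}
    (hM : D.Saturated M) : D.Saturated Mᶜ := by
  rintro A hA ⟨x, hxA, hxM⟩ y hyA hyM
  exact hxM (hM A hA ⟨y, hyA, hyM⟩ hxA)

lemma subset_compl_sUnion {X : Type*} [TopologicalSpace X] (D : Decomposition X)
    {P : Set (Set X)} (hP : P ⊆ D.pieces) {K : Set X} (hK : K ∈ D.pieces) (hKP : K ∉ P) :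
    K ⊆ (⋃₀ P)ᶜ := by
  rintro x hxK ⟨B, hB, hxB⟩
  exact hKP (D.eq_of_mem hK (hP hB) hxK hxB ▸ hB)

lemma notMem_of_subset_compl {X : Type*} [TopologicalSpace X] (D : Decomposition X)
    {P : Set (Set X)} {K : Set X} (hK : K ∈ D.pieces) (h : K ⊆ (⋃₀ P)ᶜ) : K ∉ P := by
  intro hKP
  obtain ⟨x, hx⟩ := D.nonempty' K hK
  exact h hx ⟨K, hKP, hx⟩

lemma Vanishing.exists_nhds {X : Type*} [MetricSpace X] {D : Decomposition X}
    (hD : D.Vanishing) (x : X) {W : Set X} (hW : W ∈ 𝓝 x) :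
    ∃ V ∈ 𝓝 x, V ⊆ W ∧ ∀ A ∈ D.pieces, (A ∩ V).Nonempty → x ∉ A → A ⊆ W := by
  obtain ⟨r, hr, hrW⟩ := Metric.nhds_basis_closedBall.mem_iff.1 (interior_mem_nhds.2 hW)
  obtain ⟨V, hV, hVD⟩ := hD {interior W, (Metric.closedBall x r)ᶜ} (by
      rintro u (rfl | rfl)
      · exact isOpen_interior
      · exact Metric.isClosed_closedBall.isOpen_compl) (by
      rw [sUnion_pair, eq_univ_iff_forall]
      intro y
      by_cases hy : y ∈ Metric.closedBall x r
      · exact Or.inl (hrW hy)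
      · exact Or.inr hy) x
  have hbad : ∀ A, (A ∩ Metric.ball x r).Nonempty → ¬ A ⊆ W →
      ∀ u ∈ ({interior W, (Metric.closedBall x r)ᶜ} : Set (Set X)), ¬ A ⊆ u := by
    rintro A ⟨y, hyA, hy⟩ hAW u (rfl | rfl) hAu
    · exact hAW (hAu.trans interior_subset)
    · exact hAu hyA (Metric.ball_subset_closedBall hy)
  have hV' : V ∩ Metric.ball x r ∈ 𝓝 x := Filter.inter_mem hV (Metric.ball_mem_nhds x hr)
  have hsub : V ∩ Metric.ball x r ⊆ W := fun y hy ↦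
    interior_subset (hrW (Metric.ball_subset_closedBall hy.2))
  by_cases hex : ∃ A₀ ∈ D.pieces, (A₀ ∩ (V ∩ Metric.ball x r)).Nonempty ∧ x ∉ A₀ ∧ ¬ A₀ ⊆ W
  · obtain ⟨A₀, hA₀, hne₀, hx₀, hW₀⟩ := hex
    refine ⟨(V ∩ Metric.ball x r) ∩ A₀ᶜ,
      Filter.inter_mem hV' ((D.isCompact' A₀ hA₀).isClosed.isOpen_compl.mem_nhds hx₀),
      inter_subset_left.trans hsub, ?_⟩
    rintro A hA ⟨y, hyA, ⟨hyV, hyr⟩, hyA₀⟩ _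
    by_contra hAW
    obtain ⟨z, hz₀, hzV, hzr⟩ := hne₀
    have := hVD A hA (hbad A ⟨y, hyA, hyr⟩ hAW) A₀ hA₀ (hbad A₀ ⟨z, hz₀, hzr⟩ hW₀)
      ⟨y, hyV, hyA⟩ ⟨z, hzV, hz₀⟩
    exact hyA₀ (this ▸ hyA)
  · push Not at hex
    exact ⟨_, hV', hsub, fun A hA hne hxA ↦ hex A hA hne hxA⟩

/-- The members of a vanishing decomposition of diameter at least `η` form a discrete family. -/
lemma Vanishing.discreteOn_large {X : Type*} [MetricSpace X] {D : Decomposition X}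
    (hD : D.Vanishing) {η : ℝ} (hη : 0 < η) :
    DiscreteOn univ {A ∈ D.pieces | ∃ a ∈ A, ∃ b ∈ A, η < dist a b} := by
  intro x _
  obtain ⟨V, hV, -, hVA⟩ := hD.exists_nhds x (Metric.ball_mem_nhds x (half_pos hη))
  refine ⟨V, hV, ?_⟩
  rintro A ⟨hA, a, ha, b, hb, hab⟩ hne
  by_contra hxA
  have hs := hVA A hA hne hxA
  have h1 := Metric.mem_ball.1 (hs ha)
  have h2 := Metric.mem_ball'.1 (hs hb)
  linarith [dist_triangle a x b]

/-- A piece of a vanishing decomposition has arbitrarily small saturated neighborhoods. -/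
lemma Vanishing.exists_saturated {X : Type*} [MetricSpace X] {D : Decomposition X}
    (hD : D.Vanishing) {A W : Set X} (hA : A ∈ D.pieces) (hW : IsOpen W) (hAW : A ⊆ W) :
    ∃ u, IsOpen u ∧ D.Saturated u ∧ A ⊆ u ∧ u ⊆ W := by
  refine ⟨{x | ∀ B ∈ D.pieces, x ∈ B → B ⊆ W}, ?_, ?_, ?_, ?_⟩
  · rw [isOpen_iff_mem_nhds]
    intro x hx
    obtain ⟨B, hB, hxB⟩ := D.covers x
    obtain ⟨V, hV, -, hVA⟩ := hD.exists_nhds x (hW.mem_nhds (hx B hB hxB hxB))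
    filter_upwards [hV] with y hy C hC hyC
    by_cases hxC : x ∈ C
    · exact hx C hC hxC
    · exact hVA C hC ⟨y, hyC, hy⟩ hxC
  · rintro B hB ⟨x, hxB, hx⟩ y hyB C hC hyC
    rw [D.eq_of_mem hC hB hyC hyB]
    exact hx B hB hxB
  · intro x hxA B hB hxB
    rwa [D.eq_of_mem hB hA hxB hxA]
  · intro x hx
    obtain ⟨B, hB, hxB⟩ := D.covers x
    exact hx B hB hxB hxB

lemma IsDenseDecomp.exists_nondeg_subset {X : Type*} [TopologicalSpace X] {D : Decomposition X}
    (hD : D.IsDenseDecomp) {u : Set X} (hu : IsOpen u) (hsat : D.Saturated u)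
    (hne : u.Nonempty) : ∃ A ∈ D.pieces, ¬ A.Subsingleton ∧ A ⊆ u := by
  have hpre : D.q ⁻¹' {A : D.Space | A.1 ⊆ u} = u := by
    ext x
    exact ⟨fun h ↦ h (D.mem_q x), fun h ↦ hsat _ (D.q x).2 ⟨x, D.mem_q x, h⟩⟩
  have hopen : IsOpen {A : D.Space | A.1 ⊆ u} := by
    rw [isOpen_coinduced, hpre]
    exact hu
  obtain ⟨x, hx⟩ := hne
  obtain ⟨A, hAu, hA⟩ := Dense.inter_open_nonempty hD _ hopen ⟨D.q x, by rwa [← hpre] at hx⟩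
  exact ⟨A.1, A.2, hA, hAu⟩

end Decomposition

/-! ### Expansions of discrete families and gluing of homeomorphisms -/

/-- `O` assigns disjoint open sets to the members of `𝒜`, at most one of which is met near each
point of `U`. -/
def SeparatedOn {X : Type*} [TopologicalSpace X] (U : Set X) (𝒜 : Set (Set X))
    (O : Set X → Set X) : Prop :=
  (∀ A ∈ 𝒜, IsOpen (O A) ∧ O A ⊆ U) ∧
    ∀ x ∈ U, ∃ V ∈ 𝓝 x, ∀ A ∈ 𝒜, ∀ B ∈ 𝒜, (O A ∩ V).Nonempty → (O B ∩ V).Nonempty → A = B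

lemma SeparatedOn.eq_of_mem {X : Type*} [TopologicalSpace X] {U : Set X} {𝒜 : Set (Set X)}
    {O : Set X → Set X} (hO : SeparatedOn U 𝒜 O) {A B : Set X} (hA : A ∈ 𝒜) (hB : B ∈ 𝒜)
    {x : X} (hxA : x ∈ O A) (hxB : x ∈ O B) : A = B := by
  obtain ⟨V, hV, h⟩ := hO.2 x ((hO.1 A hA).2 hxA)
  have := mem_of_mem_nhds hV
  exact h A hA B hB ⟨x, hxA, this⟩ ⟨x, hxB, this⟩

lemma SeparatedOn.shrink {X : Type*} [TopologicalSpace X] {U : Set X} {𝒜 : Set (Set X)}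
    {O O' : Set X → Set X} (hO : SeparatedOn U 𝒜 O)
    (h : ∀ A ∈ 𝒜, IsOpen (O' A) ∧ O' A ⊆ O A) : SeparatedOn U 𝒜 O' := by
  refine ⟨fun A hA ↦ ⟨(h A hA).1, (h A hA).2.trans (hO.1 A hA).2⟩, fun x hx ↦ ?_⟩
  obtain ⟨V, hV, hVO⟩ := hO.2 x hx
  exact ⟨V, hV, fun A hA B hB hA' hB' ↦ hVO A hA B hB
    (hA'.mono (inter_subset_inter_left _ (h A hA).2))
    (hB'.mono (inter_subset_inter_left _ (h B hB).2))⟩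

lemma DiscreteOn.exists_separatedOn {X : Type*} [MetricSpace X] {U : Set X} (hU : IsOpen U)
    {𝒜 : Set (Set X)} (h : DiscreteOn U 𝒜)
    (hdisj : ∀ A ∈ 𝒜, ∀ B ∈ 𝒜, A ≠ B → Disjoint A B) (hsub : ∀ A ∈ 𝒜, A ⊆ U)
    (N : Set X → Set X) (hN : ∀ A ∈ 𝒜, IsOpen (N A) ∧ A ⊆ N A) :
    ∃ O : Set X → Set X, SeparatedOn U 𝒜 O ∧ ∀ A ∈ 𝒜, A ⊆ O A ∧ O A ⊆ N A := by
  let G : Set X → Set X := fun A ↦ ⋃ k ∈ A, ⋃ δ ∈ {δ : ℝ | 0 < δ ∧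
    ∀ B ∈ 𝒜, B ≠ A → ∀ b ∈ B, δ ≤ dist k b}, Metric.ball k (δ / 4)
  have hGmem : ∀ {A y}, y ∈ G A ↔ ∃ k ∈ A, ∃ δ : ℝ, (0 < δ ∧
      ∀ B ∈ 𝒜, B ≠ A → ∀ b ∈ B, δ ≤ dist k b) ∧ dist y k < δ / 4 := by
    intro A y
    simp only [G, mem_iUnion, mem_ofPred_eq, Metric.mem_ball, exists_prop]
  have hGo : ∀ A, IsOpen (G A) := fun A ↦
    isOpen_biUnion fun _ _ ↦ isOpen_biUnion fun _ _ ↦ Metric.isOpen_ball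
  have hne : ∀ A ∈ 𝒜, ∀ B ∈ 𝒜, A ≠ B → ∀ x, x ∈ A → x ∉ B := fun A hA B hB hAB x hxA hxB ↦
    (hdisj A hA B hB hAB).le_bot ⟨hxA, hxB⟩
  refine ⟨fun A ↦ G A ∩ N A ∩ U, ⟨fun A hA ↦ ⟨((hGo A).inter (hN A hA).1).inter hU,
    inter_subset_right⟩, fun x hx ↦ ?_⟩, fun A hA ↦ ⟨fun k hk ↦ ⟨⟨?_, (hN A hA).2 hk⟩,
    hsub A hA hk⟩, fun y hy ↦ hy.1.2⟩⟩
  · obtain ⟨V, hV, hVA⟩ := h x hx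
    obtain ⟨ρ, hρ, hρV⟩ := Metric.mem_nhds_iff.1 hV
    refine ⟨Metric.ball x (ρ / 8), Metric.ball_mem_nhds x (by positivity), ?_⟩
    have hfar : ∀ A ∈ 𝒜, x ∉ A → ∀ k ∈ A, ρ ≤ dist k x := by
      intro A hA hxA k hk
      by_contra! hlt
      exact hxA (hVA A hA ⟨k, hk, hρV (Metric.mem_ball.2 hlt)⟩)
    rintro A hA B hB ⟨y, ⟨⟨hyG, -⟩, -⟩, hy⟩ ⟨z, ⟨⟨hzG, -⟩, -⟩, hz⟩
    by_contra hAB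
    obtain ⟨k, hk, δ, ⟨hδ, hδB⟩, hyk⟩ := hGmem.1 hyG
    obtain ⟨l, hl, δ', ⟨hδ', hδA⟩, hzl⟩ := hGmem.1 hzG
    have h1 := hδB B hB (Ne.symm hAB) l hl
    have h2 := hδA A hA hAB k hk
    rw [Metric.mem_ball] at hy hz
    have h3 := dist_triangle4 k y z l
    have h4 := dist_triangle_right y z x
    have h5 := dist_triangle_left k x y
    have h6 := dist_triangle_left l x z
    rw [dist_comm l k] at h2
    rw [dist_comm k y] at h3
    by_cases hxA : x ∈ A
    · have := hfar B hB (hne A hA B hB hAB x hxA) l hl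
      linarith
    · have := hfar A hA hxA k hk
      linarith
  · obtain ⟨V, hV, hVA⟩ := h k (hsub A hA hk)
    obtain ⟨ρ, hρ, hρV⟩ := Metric.mem_nhds_iff.1 hV
    refine hGmem.2 ⟨k, hk, ρ, ⟨hρ, fun B hB hBA b hb ↦ ?_⟩, by simpa using hρ⟩
    by_contra! hlt
    exact hne A hA B hB (Ne.symm hBA) k hk
      (hVA B hB ⟨b, hb, hρV (Metric.mem_ball'.2 hlt)⟩)

lemma Homeomorph.mem_of_supported {X : Type*} [TopologicalSpace X] (h : X ≃ₜ X) {O : Set X}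
    (hO : ∀ x ∉ O, h x = x) {x : X} : h x ∈ O ↔ x ∈ O := by
  constructor
  · intro hx
    by_contra hxO
    exact hxO (hO x hxO ▸ hx)
  · intro hx
    by_contra hxO
    exact hxO (by rwa [h.injective (hO _ hxO)])

lemma Homeomorph.symm_supported {X : Type*} [TopologicalSpace X] (h : X ≃ₜ X) {O : Set X}
    (hO : ∀ x ∉ O, h x = x) : ∀ x ∉ O, h.symm x = x := fun x hx ↦ by
  rw [h.symm_apply_eq, hO x hx]

open Classical in
/-- The map that equals `h A` on `O A` for all `A ∈ 𝒜` and the identity elsewhere. -/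
def glueMap {X : Type*} (𝒜 : Set (Set X)) (O : Set X → Set X) (h : Set X → X → X) (x : X) : X :=
  if hx : ∃ A ∈ 𝒜, x ∈ O A then h hx.choose x else x

lemma glueMap_of_notMem {X : Type*} {𝒜 : Set (Set X)} {O : Set X → Set X} (h : Set X → X → X)
    {x : X} (hx : ∀ A ∈ 𝒜, x ∉ O A) :
    glueMap 𝒜 O h x = x := by
  rw [glueMap, dif_neg]
  rintro ⟨A, hA, hxA⟩
  exact hx A hA hxA

section Glue

variable {X : Type*} [TopologicalSpace X] {U : Set X} {𝒜 : Set (Set X)} {O : Set X → Set X}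

lemma glueMap_of_mem (hO : SeparatedOn U 𝒜 O) (h : Set X → X → X) {A : Set X} (hA : A ∈ 𝒜)
    {x : X} (hx : x ∈ O A) : glueMap 𝒜 O h x = h A x := by
  have hex : ∃ A ∈ 𝒜, x ∈ O A := ⟨A, hA, hx⟩
  rw [glueMap, dif_pos hex, hO.eq_of_mem hex.choose_spec.1 hA hex.choose_spec.2 hx]

lemma glueMap_leftInverse (hO : SeparatedOn U 𝒜 O) {f g : Set X → X → X}
    (hf : ∀ A ∈ 𝒜, ∀ x ∈ O A, f A x ∈ O A) (hfg : ∀ A ∈ 𝒜, ∀ x, g A (f A x) = x) (x : X) :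
    glueMap 𝒜 O g (glueMap 𝒜 O f x) = x := by
  by_cases hx : ∃ A ∈ 𝒜, x ∈ O A
  · obtain ⟨A, hA, hxA⟩ := hx
    rw [glueMap_of_mem hO f hA hxA, glueMap_of_mem hO g hA (hf A hA x hxA), hfg A hA]
  · push Not at hx
    rw [glueMap_of_notMem f hx, glueMap_of_notMem g hx]

lemma glueMap_mapsTo (hO : SeparatedOn U 𝒜 O) {f : Set X → X → X}
    (hf : ∀ A ∈ 𝒜, ∀ x ∈ O A, f A x ∈ O A) : MapsTo (glueMap 𝒜 O f) U U := by
  intro x hxU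
  by_cases hx : ∃ A ∈ 𝒜, x ∈ O A
  · obtain ⟨A, hA, hxA⟩ := hx
    rw [glueMap_of_mem hO f hA hxA]
    exact (hO.1 A hA).2 (hf A hA x hxA)
  · push Not at hx
    rwa [glueMap_of_notMem f hx]

lemma continuousOn_glueMap (hO : SeparatedOn U 𝒜 O) {f : Set X → X → X}
    (hf : ∀ A ∈ 𝒜, ∀ x ∉ O A, f A x = x) (hc : ∀ A ∈ 𝒜, Continuous (f A)) :
    ContinuousOn (glueMap 𝒜 O f) U := by
  intro x hxU
  refine ContinuousAt.continuousWithinAt ?_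
  by_cases hx : ∃ A ∈ 𝒜, x ∈ O A
  · obtain ⟨A, hA, hxA⟩ := hx
    refine (hc A hA).continuousAt.congr ?_
    filter_upwards [(hO.1 A hA).1.mem_nhds hxA] with y hy
    rw [glueMap_of_mem hO f hA hy]
  · push Not at hx
    obtain ⟨V, hV, hVO⟩ := hO.2 x hxU
    by_cases hex : ∃ A ∈ 𝒜, (O A ∩ V).Nonempty
    · obtain ⟨A, hA, hne⟩ := hex
      refine (hc A hA).continuousAt.congr ?_
      filter_upwards [hV] with y hy
      by_cases hyA : y ∈ O A
      · rw [glueMap_of_mem hO f hA hyA]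
      · rw [hf A hA y hyA, glueMap_of_notMem]
        intro B hB hyB
        exact hyA (hVO B hB A hA ⟨y, hyB, hy⟩ hne ▸ hyB)
    · push Not at hex
      refine continuousAt_id.congr ?_
      filter_upwards [hV] with y hy
      rw [glueMap_of_notMem, id]
      intro B hB hyB
      exact (hex B hB).subset ⟨hyB, hy⟩

/-- A discrete family of homeomorphisms of `X` with supports in `U` glues to a
homeomorphism of `U`. -/
def glueHomeomorph (hO : SeparatedOn U 𝒜 O) (h : Set X → X ≃ₜ X)
    (hh : ∀ A ∈ 𝒜, ∀ x ∉ O A, h A x = x) : U ≃ₜ U where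
  toFun := (glueMap_mapsTo (f := fun A ↦ h A) hO
    fun A hA _ hx ↦ ((h A).mem_of_supported (hh A hA)).2 hx).restrict _ _ _
  invFun := (glueMap_mapsTo (f := fun A ↦ (h A).symm) hO
    fun A hA _ hx ↦ ((h A).symm.mem_of_supported ((h A).symm_supported (hh A hA))).2
      hx).restrict _ _ _
  left_inv x := Subtype.ext <| glueMap_leftInverse (f := fun A ↦ h A) hO
    (fun A hA _ hx ↦ ((h A).mem_of_supported (hh A hA)).2 hx)
    (fun A _ x ↦ (h A).symm_apply_apply x) x
  right_inv x := Subtype.ext <| glueMap_leftInverse (f := fun A ↦ (h A).symm) hO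
    (fun A hA _ hx ↦ ((h A).symm.mem_of_supported ((h A).symm_supported (hh A hA))).2 hx)
    (fun A _ x ↦ (h A).apply_symm_apply x) x
  continuous_toFun := (continuousOn_glueMap hO hh
    fun A _ ↦ (h A).continuous).mapsToRestrict _
  continuous_invFun := (continuousOn_glueMap hO (fun A hA ↦ (h A).symm_supported (hh A hA))
    fun A _ ↦ (h A).symm.continuous).mapsToRestrict _

lemma glueHomeomorph_apply (hO : SeparatedOn U 𝒜 O) (h : Set X → X ≃ₜ X)
    (hh : ∀ A ∈ 𝒜, ∀ x ∉ O A, h A x = x) (x : U) :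
    (glueHomeomorph hO h hh x : X) = glueMap 𝒜 O (fun A ↦ h A) x := rfl

/-- Gluing a discrete family of homeomorphisms of `X`. -/
lemma exists_glue (hO : SeparatedOn univ 𝒜 O) (h : Set X → X ≃ₜ X)
    (hh : ∀ A ∈ 𝒜, ∀ x ∉ O A, h A x = x) :
    ∃ g : X ≃ₜ X, (∀ A ∈ 𝒜, ∀ x ∈ O A, g x = h A x) ∧
      ∀ x, (∀ A ∈ 𝒜, x ∉ O A) → g x = x := by
  refine ⟨(Homeomorph.Set.univ X).symm.trans
    ((glueHomeomorph hO h hh).trans (Homeomorph.Set.univ X)), fun A hA x hx ↦ ?_, fun x hx ↦ ?_⟩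
  · exact glueMap_of_mem hO (fun A ↦ h A) hA hx
  · exact glueMap_of_notMem (fun A ↦ h A) hx

end Glue

open Classical in
/-- A homeomorphism of an open set that tends to the identity at the boundary, as does its
inverse, extends by the identity. -/
lemma exists_extension {X : Type*} [TopologicalSpace X] {U : Set X} (hU : IsOpen U) (h : U ≃ₜ U)
    (R : X → X → Prop) (hR : ∀ x : U, R x (h x) ∧ R (h x) x)
    (hbd : ∀ m ∉ U, ∀ W ∈ 𝓝 m, ∃ V ∈ 𝓝 m, ∀ x ∈ V, ∀ y, R x y → y ∈ W) :
    ∃ H : X ≃ₜ X, (∀ x : U, H x = h x) ∧ ∀ x ∉ U, H x = x := by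
  let F : (U → U) → X → X := fun f x ↦ if hx : x ∈ U then f ⟨x, hx⟩ else x
  have hFm : ∀ f (x : U), F f x = f x := fun f x ↦ dif_pos x.2
  have hFn : ∀ f, ∀ x ∉ U, F f x = x := fun f x hx ↦ dif_neg hx
  have hFF : ∀ f g : U → U, (∀ x, g (f x) = x) → ∀ x, F g (F f x) = x := by
    intro f g hfg x
    by_cases hx : x ∈ U
    · lift x to U using hx
      rw [hFm, hFm, hfg]
    · rw [hFn f x hx, hFn g x hx]
  have hFc : ∀ f : U → U, Continuous f → (∀ x : U, R x (f x)) → Continuous (F f) := by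
    intro f hf hfR
    rw [continuous_iff_continuousAt]
    intro x
    by_cases hx : x ∈ U
    · refine ContinuousOn.continuousAt ?_ (hU.mem_nhds hx)
      rw [continuousOn_iff_continuous_domRestrict]
      have : U.domRestrict (F f) = fun y ↦ (f y : X) := funext fun y ↦ hFm f y
      rw [this]
      exact continuous_subtype_val.comp hf
    · rw [ContinuousAt, hFn f x hx]
      intro W hW
      obtain ⟨V, hV, hVW⟩ := hbd x hx W hW
      rw [Filter.mem_map]
      filter_upwards [hV, hW] with y hyV hyW
      by_cases hy : y ∈ U
      · have := hVW y hyV _ (hfR ⟨y, hy⟩)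
        rwa [← hFm f ⟨y, hy⟩] at this
      · rwa [mem_preimage, hFn f y hy]
  refine ⟨⟨⟨F h, F h.symm, ?_, ?_⟩, ?_, ?_⟩, fun x ↦ hFm _ x, fun x ↦ hFn _ x⟩
  · exact hFF _ _ h.symm_apply_apply
  · exact hFF _ _ h.apply_symm_apply
  · exact hFc _ h.continuous fun x ↦ (hR x).1
  · refine hFc _ h.symm.continuous fun x ↦ ?_
    have := (hR (h.symm x)).2
    rwa [h.apply_symm_apply] at this

/-! ### Controlled shrinking -/

/-- A strongly shrinkable vanishing decomposition can be shrunk relative to a closed saturated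
set `M` by a homeomorphism of the whole space which moves points only within prescribed
neighborhoods of pieces. -/
lemma Decomposition.StronglyShrinkable.exists_homeomorph {X : Type*} [MetricSpace X]
    {D : Decomposition X} (hs : D.StronglyShrinkable) (hv : D.Vanishing) {M : Set X}
    (hMc : IsClosed M) (hM : D.Saturated M) (N : Set X → Set X)
    (hN : ∀ K ∈ D.pieces, IsOpen (N K) ∧ K ⊆ N K) (𝒱 : Set (Set X))
    (h𝒱 : ∀ v ∈ 𝒱, IsOpen v) (hcov : Mᶜ ⊆ ⋃₀ 𝒱) :
    ∃ h : X ≃ₜ X, (∀ x ∈ M, h x = x) ∧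
      (∀ x, h x = x ∨ ∃ K ∈ D.pieces, K ⊆ Mᶜ ∧ x ∈ N K ∧ h x ∈ N K) ∧
      ∀ K ∈ D.pieces, K ⊆ Mᶜ → ∃ v ∈ 𝒱, ⇑h '' K ⊆ v := by
  let G : Set X → Set X := fun K ↦ ⋃ k ∈ K, ⋃ δ ∈ {δ : ℝ | 0 < δ ∧ ∀ m ∈ M, δ ≤ dist k m},
    Metric.ball k (δ / 2)
  have hGmem : ∀ {K y}, y ∈ G K ↔ ∃ k ∈ K, ∃ δ : ℝ, (0 < δ ∧ ∀ m ∈ M, δ ≤ dist k m) ∧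
      dist y k < δ / 2 := by
    intro K y
    simp only [G, mem_iUnion, mem_ofPred_eq, Metric.mem_ball, exists_prop]
  have hGo : ∀ K, IsOpen (G K) := fun K ↦
    isOpen_biUnion fun _ _ ↦ isOpen_biUnion fun _ _ ↦ Metric.isOpen_ball
  have hGM : ∀ K, G K ⊆ Mᶜ := by
    intro K y hy hyM
    obtain ⟨k, hk, δ, ⟨hδ, hδM⟩, hyk⟩ := hGmem.1 hy
    have := hδM y hyM
    rw [dist_comm] at this
    linarith
  have hKG : ∀ K, K ⊆ Mᶜ → K ⊆ G K := by
    intro K hK k hk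
    obtain ⟨δ, hδ, hδM⟩ := Metric.isOpen_iff.1 hMc.isOpen_compl k (hK hk)
    refine hGmem.2 ⟨k, hk, δ, ⟨hδ, fun m hm ↦ ?_⟩, by simpa using hδ⟩
    by_contra! hlt
    exact hδM (Metric.mem_ball'.2 hlt) hm
  let 𝒰 : Set (Set X) := {u | IsOpen u ∧ D.Saturated u ∧ ∃ K ∈ D.pieces, K ⊆ Mᶜ ∧
    u ⊆ N K ∩ G K}
  obtain ⟨h, hnear, hsmall⟩ := hs Mᶜ hMc.isOpen_compl hM.compl 𝒰 (by
      rintro u ⟨hu, hsat, K, hK, hKM, huK⟩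
      exact ⟨hu, fun y hy ↦ hGM K (huK hy).2, fun A hA _ hne ↦ hsat A hA hne⟩) (by
      intro x hx
      obtain ⟨K, hK, hxK⟩ := D.covers x
      have hKM := hM.compl K hK ⟨x, hxK, hx⟩
      obtain ⟨u, hu, hsat, hKu, huW⟩ := hv.exists_saturated hK ((hN K hK).1.inter (hGo K))
        (subset_inter (hN K hK).2 (hKG K hKM))
      exact ⟨u, ⟨hu, hsat, K, hK, hKM, huW⟩, hKu hxK⟩) ((fun v ↦ v ∩ Mᶜ) '' 𝒱) (by
      rintro _ ⟨v, hv, rfl⟩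
      exact ⟨(h𝒱 v hv).inter hMc.isOpen_compl, inter_subset_right⟩) (by
      intro x hx
      obtain ⟨v, hv, hxv⟩ := hcov hx
      exact ⟨_, ⟨v, hv, rfl⟩, hxv, hx⟩)
  have hnear' : ∀ x : ↥Mᶜ, (h x : X) = x ∨ ∃ K ∈ D.pieces, K ⊆ Mᶜ ∧
      (x : X) ∈ N K ∩ G K ∧ (h x : X) ∈ N K ∩ G K := by
    intro x
    by_cases hx : (h x : X) = x
    · exact Or.inl hx
    · obtain ⟨u, ⟨-, -, K, hK, hKM, huK⟩, h1, h2⟩ := hnear x hx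
      exact Or.inr ⟨K, hK, hKM, huK h2, huK h1⟩
  obtain ⟨H, hHU, hHM⟩ := exists_extension hMc.isOpen_compl h
    (fun x y ↦ y = x ∨ ∃ K ∈ D.pieces, K ⊆ Mᶜ ∧ x ∈ G K ∧ y ∈ G K) (by
      intro x
      rcases hnear' x with hx | ⟨K, hK, hKM, h1, h2⟩
      · exact ⟨Or.inl hx, Or.inl hx.symm⟩
      · exact ⟨Or.inr ⟨K, hK, hKM, h1.2, h2.2⟩, Or.inr ⟨K, hK, hKM, h2.2, h1.2⟩⟩) (by
      intro m hm W hW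
      rw [notMem_compl_iff] at hm
      obtain ⟨η, hη, hηW⟩ := Metric.mem_nhds_iff.1 hW
      obtain ⟨V, hV, -, hVD⟩ := hv.exists_nhds m (Metric.ball_mem_nhds m (half_pos hη))
      obtain ⟨ρ, hρ, hρV⟩ := Metric.mem_nhds_iff.1 hV
      refine ⟨Metric.ball m (ρ / 2) ∩ W, Filter.inter_mem
        (Metric.ball_mem_nhds m (half_pos hρ)) hW, ?_⟩
      rintro x ⟨hx, hxW⟩ y (rfl | ⟨K, hK, hKM, hxK, hyK⟩)
      · exact hxW
      · obtain ⟨k, hk, δ, ⟨hδ, hδM⟩, hxk⟩ := hGmem.1 hxK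
        obtain ⟨l, hl, δ', ⟨hδ', hδM'⟩, hyl⟩ := hGmem.1 hyK
        have h1 := hδM m hm
        have h2 := hδM' m hm
        have h3 := dist_triangle_left k m x
        have hkV : k ∈ Metric.ball m ρ := by
          rw [Metric.mem_ball] at hx ⊢
          linarith
        have hlW := Metric.mem_ball.1
          (hVD K hK ⟨k, hk, hρV hkV⟩ (fun hmK ↦ hKM hmK hm) hl)
        apply hηW
        rw [Metric.mem_ball]
        linarith [dist_triangle y l m])
  refine ⟨H, fun x hx ↦ hHM x (not_not_intro hx), fun x ↦ ?_, fun K hK hKM ↦ ?_⟩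
  · by_cases hx : x ∈ M
    · exact Or.inl (hHM x (not_not_intro hx))
    · have := hnear' ⟨x, hx⟩
      rw [← hHU ⟨x, hx⟩] at this
      rcases this with h0 | ⟨K, hK, hKM, h1, h2⟩
      · exact Or.inl h0
      · exact Or.inr ⟨K, hK, hKM, h1.1, h2.1⟩
  · obtain ⟨_, ⟨v, hv, rfl⟩, hsub⟩ := hsmall K hK hKM
    refine ⟨v, hv, ?_⟩
    rintro _ ⟨x, hx, rfl⟩
    have := hsub ⟨_, ⟨⟨x, hKM hx⟩, hx, rfl⟩, rfl⟩
    rw [hHU ⟨x, hKM hx⟩]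
    exact this.1

/-! ### Partial matchings of two decompositions -/

/-- The nondegenerate pieces of a decomposition. -/
def Decomposition.nontrivialPieces {X : Type*} [TopologicalSpace X] (D : Decomposition X) :
    Set (Set X) := {A ∈ D.pieces | ¬ A.Subsingleton}

/-- A homeomorphism together with discrete families of nondegenerate pieces of `D` and of `E`
that correspond to each other. -/
structure Matching {X : Type*} [TopologicalSpace X] (D E : Decomposition X) where
  /-- the underlying homeomorphism -/
  homeo : X ≃ₜ X
  /-- the matched pieces of `D` -/
  left : Set (Set X)
  /-- the matched pieces of `E` -/
  right : Set (Set X)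
  left_subset : left ⊆ D.nontrivialPieces
  right_subset : right ⊆ E.nontrivialPieces
  left_discrete : DiscreteOn univ left
  right_discrete : DiscreteOn univ right
  image_mem : ∀ K ∈ left, ⇑homeo '' K ∈ right
  symm_image_mem : ∀ L ∈ right, ⇑homeo.symm '' L ∈ left

namespace Matching

section Topological

variable {X : Type*} [TopologicalSpace X] {D E : Decomposition X}

/-- The inverse matching. -/
def symm (s : Matching D E) : Matching E D where
  homeo := s.homeo.symm
  left := s.right
  right := s.left
  left_subset := s.right_subset
  right_subset := s.left_subset
  left_discrete := s.right_discrete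
  right_discrete := s.left_discrete
  image_mem := s.symm_image_mem
  symm_image_mem := s.image_mem

lemma left_subset_pieces (s : Matching D E) : s.left ⊆ D.pieces :=
  fun _ hK ↦ (s.left_subset hK).1

lemma apply_mem (s : Matching D E) {x : X} (hx : x ∈ ⋃₀ s.left) : s.homeo x ∈ ⋃₀ s.right := by
  obtain ⟨K, hK, hxK⟩ := hx
  exact ⟨_, s.image_mem K hK, mem_image_of_mem _ hxK⟩

lemma apply_mem_iff (s : Matching D E) {x : X} :
    s.homeo x ∈ ⋃₀ s.right ↔ x ∈ ⋃₀ s.left := by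
  refine ⟨fun hx ↦ ?_, s.apply_mem⟩
  have := s.symm.apply_mem hx
  rwa [symm, s.homeo.symm_apply_apply] at this

/-- `t` matches more pieces than `s`, and agrees with `s` on those matched by `s`. -/
structure Le (s t : Matching D E) : Prop where
  left_subset : s.left ⊆ t.left
  right_subset : s.right ⊆ t.right
  eqOn : EqOn t.homeo s.homeo (⋃₀ s.left)

lemma Le.refl (s : Matching D E) : s.Le s := ⟨Subset.rfl, Subset.rfl, fun _ _ ↦ rfl⟩

lemma Le.trans {s t u : Matching D E} (h : s.Le t) (h' : t.Le u) : s.Le u :=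
  ⟨h.left_subset.trans h'.left_subset, h.right_subset.trans h'.right_subset,
    (h'.eqOn.mono (sUnion_subset_sUnion h.left_subset)).trans h.eqOn⟩

lemma Le.symm {s t : Matching D E} (h : s.Le t) : s.symm.Le t.symm := by
  refine ⟨h.right_subset, h.left_subset, fun x hx ↦ ?_⟩
  have hx' : s.homeo.symm x ∈ ⋃₀ s.left := s.symm.apply_mem hx
  change t.homeo.symm x = s.homeo.symm x
  rw [t.homeo.symm_apply_eq, h.eqOn hx', s.homeo.apply_symm_apply]

lemma exists_extend (s : Matching D E) (Ψ : X ≃ₜ X) (hΨ : EqOn Ψ s.homeo (⋃₀ s.left))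
    {𝒜 : Set (Set X)} (h𝒜 : 𝒜 ⊆ D.nontrivialPieces) (hd : DiscreteOn univ 𝒜)
    (him : ∀ K ∈ 𝒜, ⇑Ψ '' K ∈ E.nontrivialPieces) :
    ∃ t : Matching D E, t.homeo = Ψ ∧ t.left = s.left ∪ 𝒜 ∧ s.Le t := by
  have hd' : DiscreteOn univ (s.right ∪ (fun K ↦ ⇑Ψ '' K) '' 𝒜) :=
    s.right_discrete.union (hd.image_homeomorph Ψ)
  have himg : ∀ K ∈ s.left, ⇑Ψ '' K = ⇑s.homeo '' K := fun K hK ↦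
    image_congr fun x hx ↦ hΨ ⟨K, hK, hx⟩
  refine ⟨⟨Ψ, s.left ∪ 𝒜, s.right ∪ (fun K ↦ ⇑Ψ '' K) '' 𝒜,
    union_subset s.left_subset h𝒜, union_subset s.right_subset ?_,
    s.left_discrete.union hd, hd', ?_, ?_⟩, rfl, rfl,
    ⟨subset_union_left, subset_union_left, hΨ⟩⟩
  · rintro _ ⟨K, hK, rfl⟩
    exact him K hK
  · rintro K (hK | hK)
    · rw [himg K hK]
      exact Or.inl (s.image_mem K hK)
    · exact Or.inr ⟨K, hK, rfl⟩
  · rintro L (hL | ⟨K, hK, rfl⟩)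
    · have h1 := s.symm_image_mem L hL
      have h2 := himg _ h1
      rw [← image_comp s.homeo, s.homeo.self_comp_symm, image_id] at h2
      rw [← h2, ← image_comp, Ψ.symm_comp_self, image_id]
      exact Or.inl h1
    · right
      simpa only [← image_comp, Ψ.symm_comp_self, image_id] using hK

end Topological

variable {X : Type*} [MetricSpace X] {D E : Decomposition X}

/-- All unmatched pieces of `D` have diameter at most `a`, and their images have diameter at
most `b`. -/
def Fine (s : Matching D E) (a b : ℝ) : Prop :=
  ∀ K ∈ D.pieces, K ∉ s.left → ∀ x ∈ K, ∀ y ∈ K,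
    dist x y ≤ a ∧ dist (s.homeo x) (s.homeo y) ≤ b

/-- The homeomorphisms of `s` and `t` are `a`-close, and their inverses are `b`-close. -/
def Close (s t : Matching D E) (a b : ℝ) : Prop :=
  (∀ x, dist (s.homeo x) (t.homeo x) ≤ a) ∧ ∀ x, dist (s.homeo.symm x) (t.homeo.symm x) ≤ b

lemma Close.symm {s t : Matching D E} {a b : ℝ} (h : s.Close t a b) :
    s.symm.Close t.symm b a := ⟨h.2, h.1⟩

lemma Close.trans {s t u : Matching D E} {a b a' b' : ℝ} (h : s.Close t a b)
    (h' : t.Close u a' b') : s.Close u (a + a') (b + b') :=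
  ⟨fun x ↦ (dist_triangle _ _ _).trans (add_le_add (h.1 x) (h'.1 x)),
    fun x ↦ (dist_triangle _ _ _).trans (add_le_add (h.2 x) (h'.2 x))⟩

lemma Fine.mono {s : Matching D E} {a b a' b' : ℝ} (h : s.Fine a b) (ha : a ≤ a')
    (hb : b ≤ b') : s.Fine a' b' := fun K hK hKs x hx y hy ↦
  ⟨(h K hK hKs x hx y hy).1.trans ha, (h K hK hKs x hx y hy).2.trans hb⟩

lemma Fine.of_close {s t : Matching D E} {a b c d : ℝ} (h : s.Fine a b) (hst : s.Close t c d)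
    (hl : s.left ⊆ t.left) : t.Fine a (b + 2 * c) := by
  intro K hK hKt x hx y hy
  obtain ⟨h1, h2⟩ := h K hK (fun hKs ↦ hKt (hl hKs)) x hx y hy
  refine ⟨h1, ?_⟩
  have h3 := dist_triangle4_right (t.homeo x) (t.homeo y) (s.homeo x) (s.homeo y)
  rw [dist_comm (t.homeo x) (s.homeo x), dist_comm (t.homeo y) (s.homeo y)] at h3
  linarith [hst.1 x, hst.1 y]

lemma exists_shrink_homeo (s : Matching D E) (hv : D.Vanishing) (hs : D.StronglyShrinkable)
    {a b r : ℝ} (ha : 0 ≤ a) (hb : 0 ≤ b) (hr : 0 < r) (hfine : s.Fine a b) (𝒱 : Set (Set X))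
    (h𝒱 : ∀ v ∈ 𝒱, IsOpen v) (hcov : (⋃₀ s.left)ᶜ ⊆ ⋃₀ 𝒱) :
    ∃ h : X ≃ₜ X, (∀ x ∈ ⋃₀ s.left, h x = x) ∧
      (∀ x, dist x (h x) ≤ a + 2 * r ∧ dist (s.homeo x) (s.homeo (h x)) ≤ b + 2 * r) ∧
      ∀ K ∈ D.pieces, K ∉ s.left → ∃ v ∈ 𝒱, ⇑h '' K ⊆ v := by
  obtain ⟨h, h1, h2, h3⟩ := hs.exists_homeomorph hv s.left_discrete.isClosed_sUnion
    (D.saturated_sUnion s.left_subset_pieces)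
    (fun K ↦ ⋃ k ∈ K, Metric.ball k r ∩ s.homeo ⁻¹' Metric.ball (s.homeo k) r) (fun K hK ↦
      ⟨isOpen_biUnion fun k _ ↦ Metric.isOpen_ball.inter
        (Metric.isOpen_ball.preimage s.homeo.continuous), fun k hk ↦
        mem_biUnion hk ⟨Metric.mem_ball_self hr, Metric.mem_ball_self hr⟩⟩) 𝒱 h𝒱 hcov
  refine ⟨h, h1, fun x ↦ ?_, fun K hK hKs ↦
    h3 K hK (D.subset_compl_sUnion s.left_subset_pieces hK hKs)⟩
  rcases h2 x with hx | ⟨K, hK, hKM, hx, hhx⟩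
  · rw [hx, dist_self, dist_self]
    constructor <;> positivity
  · simp only [mem_iUnion, mem_inter_iff, Metric.mem_ball, mem_preimage, exists_prop] at hx hhx
    obtain ⟨k, hk, hk1, hk2⟩ := hx
    obtain ⟨l, hl, hl1, hl2⟩ := hhx
    obtain ⟨h4, h5⟩ := hfine K hK (D.notMem_of_subset_compl hK hKM) k hk l hl
    constructor
    · have := dist_triangle4_right x (h x) k l
      linarith
    · have := dist_triangle4_right (s.homeo x) (s.homeo (h x)) (s.homeo k) (s.homeo l)
      linarith

lemma exists_shrink (s : Matching D E) (hv : D.Vanishing) (hs : D.StronglyShrinkable)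
    {a b η : ℝ} (ha : 0 ≤ a) (hb : 0 ≤ b) (hη : 0 < η) (hfine : s.Fine a b) :
    ∃ t : Matching D E, s.Le t ∧ t.Fine a η ∧ s.Close t (b + 2 * η) (a + 2 * η) := by
  obtain ⟨h, h1, h2, h3⟩ := s.exists_shrink_homeo hv hs ha hb hη hfine
    (range fun y ↦ s.homeo ⁻¹' Metric.ball (s.homeo y) (η / 2)) (by
      rintro _ ⟨y, rfl⟩
      exact Metric.isOpen_ball.preimage s.homeo.continuous)
    (fun y _ ↦ ⟨_, ⟨y, rfl⟩, Metric.mem_ball_self (half_pos hη)⟩)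
  obtain ⟨t, ht, htl, hst⟩ := s.exists_extend (h.trans s.homeo)
    (fun x hx ↦ congrArg s.homeo (h1 x hx)) (empty_subset _) (fun x _ ↦ ⟨univ, Filter.univ_mem,
      fun A hA ↦ hA.elim⟩) (fun K hK ↦ hK.elim)
  rw [union_empty] at htl
  refine ⟨t, hst, fun K hK hKt x hx y hy ↦ ?_, fun x ↦ ?_, fun x ↦ ?_⟩
  · rw [htl] at hKt
    refine ⟨(hfine K hK hKt x hx y hy).1, ?_⟩
    obtain ⟨_, ⟨z, rfl⟩, hz⟩ := h3 K hK hKt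
    have hx' : dist (s.homeo (h x)) (s.homeo z) < η / 2 := hz (mem_image_of_mem _ hx)
    have hy' : dist (s.homeo (h y)) (s.homeo z) < η / 2 := hz (mem_image_of_mem _ hy)
    rw [ht]
    have := dist_triangle_right (s.homeo (h x)) (s.homeo (h y)) (s.homeo z)
    change dist (s.homeo (h x)) (s.homeo (h y)) ≤ η
    linarith
  · rw [ht]
    exact (h2 x).2
  · rw [ht]
    have := (h2 (h.symm (s.homeo.symm x))).1
    rw [h.apply_symm_apply, dist_comm] at this
    exact this

end Matching

/-! ### Matching discrete families of pieces -/

lemma IsTameFamily.exists_shift {X : Type*} [TopologicalSpace X] {𝒦 : Set (Set X)}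
    (h𝒦 : IsTameFamily 𝒦) {K O : Set X} (hK : K ∈ 𝒦) (hO : IsOpen O) (hKO : K ⊆ O) :
    ∃ (h : X ≃ₜ X) (U : Set X), (∀ x ∉ O, h x = x) ∧ IsOpen U ∧ U ⊆ O ∧ ⇑h '' K ⊆ U ∧
      ∀ B ∈ 𝒦, B ⊆ U → ∃ f : X ≃ₜ X, (∀ x ∉ O, f x = x) ∧ ⇑f '' K = B := by
  obtain ⟨-, hinv, hshr, hshift, -⟩ := h𝒦
  obtain ⟨h, hh, U, ⟨hU, hUO, hUs⟩, hKU⟩ := hshr K hK O hO hKO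
    {U | IsOpen U ∧ U ⊆ O ∧ ∀ A ∈ 𝒦, ∀ B ∈ 𝒦, A ⊆ U → B ⊆ U →
      ∃ f : X ≃ₜ X, ⇑f '' A = B ∧ ∀ y ∉ O, f y = y} (fun U hU ↦ ⟨hU.1, hU.2.1⟩) (by
      intro x hx
      obtain ⟨U, hU, hUO, hUs⟩ := hshift x O (hO.mem_nhds hx)
      exact ⟨interior U, ⟨isOpen_interior, interior_subset.trans hUO, fun A hA B hB hAU hBU ↦
        hUs A hA B hB (hAU.trans interior_subset) (hBU.trans interior_subset)⟩,
        mem_interior_iff_mem_nhds.2 hU⟩)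
  refine ⟨h, U, hh, hU, hUO, hKU, fun B hB hBU ↦ ?_⟩
  obtain ⟨f, hf, hfO⟩ := hUs _ (hinv h K hK) B hB hKU hBU
  refine ⟨h.trans f, fun x hx ↦ ?_, ?_⟩
  · rw [Homeomorph.trans_apply, hh x hx, hfO x hx]
  · rwa [← image_comp] at hf

namespace Matching

variable {X : Type*} [MetricSpace X] {D E : Decomposition X}

/-- Move the pieces of a discrete family onto pieces of `E`. -/
lemma exists_match {𝒦 : Set (Set X)} (h𝒦 : IsTameFamily 𝒦) (hD : D.KTame 𝒦) (hE : E.KTame 𝒦)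
    (hEd : E.IsDenseDecomp) (s : Matching D E) {𝒜 : Set (Set X)}
    (h𝒜 : 𝒜 ⊆ D.nontrivialPieces) (hs𝒜 : ∀ K ∈ 𝒜, K ∉ s.left) (hd : DiscreteOn univ 𝒜)
    {ε : ℝ} (hε : 0 < ε) (hf : s.Fine ε ε) (hf' : s.symm.Fine ε ε) :
    ∃ t : Matching D E, s.Le t ∧ 𝒜 ⊆ t.left ∧ s.Close t (5 * ε) (5 * ε) := by
  have h𝒜𝒦 : ∀ K ∈ 𝒜, K ∈ 𝒦 := fun K hK ↦ hD.2.2 K (h𝒜 hK).1 (h𝒜 hK).2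
  have hMc := s.left_discrete.isClosed_sUnion
  have h𝒜M : ∀ K ∈ 𝒜, K ⊆ (⋃₀ s.left)ᶜ := fun K hK ↦
    D.subset_compl_sUnion s.left_subset_pieces (h𝒜 hK).1 (hs𝒜 K hK)
  obtain ⟨O, hO, hKO⟩ := hd.exists_separatedOn isOpen_univ
    (fun A hA B hB ↦ D.disjoint' A (h𝒜 hA).1 B (h𝒜 hB).1) (fun A _ ↦ subset_univ A)
    (fun K ↦ (⋃ k ∈ K, Metric.ball k ε ∩ s.homeo ⁻¹' Metric.ball (s.homeo k) ε) ∩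
      (⋃₀ s.left)ᶜ) (fun K hK ↦
      ⟨(isOpen_biUnion fun k _ ↦ Metric.isOpen_ball.inter
        (Metric.isOpen_ball.preimage s.homeo.continuous)).inter hMc.isOpen_compl, fun k hk ↦
        ⟨mem_biUnion hk ⟨Metric.mem_ball_self hε, Metric.mem_ball_self hε⟩, h𝒜M K hK hk⟩⟩)
  have hOM : ∀ K ∈ 𝒜, O K ⊆ (⋃₀ s.left)ᶜ := fun K hK ↦
    (hKO K hK).2.trans inter_subset_right
  have hOdist : ∀ K ∈ 𝒜, ∀ x ∈ O K, ∀ y ∈ O K,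
      dist x y ≤ 3 * ε ∧ dist (s.homeo x) (s.homeo y) ≤ 3 * ε := by
    intro K hK x hx y hy
    have hx' := ((hKO K hK).2 hx).1
    have hy' := ((hKO K hK).2 hy).1
    simp only [mem_iUnion, mem_inter_iff, Metric.mem_ball, mem_preimage, exists_prop] at hx' hy'
    obtain ⟨k, hk, hk1, hk2⟩ := hx'
    obtain ⟨l, hl, hl1, hl2⟩ := hy'
    obtain ⟨h4, h5⟩ := hf K (h𝒜 hK).1 (hs𝒜 K hK) k hk l hl
    constructor
    · linarith [dist_triangle4_right x y k l]
    · linarith [dist_triangle4_right (s.homeo x) (s.homeo y) (s.homeo k) (s.homeo l)]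
  have hsh := fun K : 𝒜 ↦ h𝒦.exists_shift (h𝒜𝒦 K K.2) (hO.1 K K.2).1 (hKO K K.2).1
  choose h' U' hh' hU' hUO' hKU' hshift' using hsh
  -- the sets into which the pieces are to be shrunk
  classical
  let h : Set X → X ≃ₜ X := fun K ↦ if hK : K ∈ 𝒜 then h' ⟨K, hK⟩ else Homeomorph.refl X
  have hh : ∀ K (hK : K ∈ 𝒜), h K = h' ⟨K, hK⟩ := fun K hK ↦ dif_pos hK
  obtain ⟨g, hg, -⟩ := exists_glue hO h (fun K hK ↦ by rw [hh K hK]; exact hh' ⟨K, hK⟩)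
  have hgK : ∀ K (hK : K ∈ 𝒜), ⇑g '' K ⊆ U' ⟨K, hK⟩ := by
    rintro K hK _ ⟨x, hx, rfl⟩
    rw [hg K hK x ((hKO K hK).1 hx), hh K hK]
    exact hKU' ⟨K, hK⟩ (mem_image_of_mem _ hx)
  obtain ⟨e, he, hedist, heL⟩ := s.symm.exists_shrink_homeo hE.1 hE.2.1 hε.le hε.le
    (half_pos hε) hf' (insert (s.homeo '' (g '' ⋃₀ 𝒜)ᶜ) (range fun K : 𝒜 ↦ s.homeo '' U' K))
    (by
      rintro v (rfl | ⟨K, rfl⟩)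
      · rw [s.homeo.isOpen_image, isOpen_compl_iff, g.isClosed_image]
        exact hd.isClosed_sUnion
      · exact s.homeo.isOpen_image.2 (hU' K)) (by
      intro x _
      by_cases hx : s.homeo.symm x ∈ g '' ⋃₀ 𝒜
      · obtain ⟨y, ⟨K, hK, hyK⟩, hy⟩ := hx
        exact ⟨_, Or.inr ⟨⟨K, hK⟩, rfl⟩, s.homeo.symm x, hy ▸ hgK K hK (mem_image_of_mem _ hyK),
          s.homeo.apply_symm_apply x⟩
      · exact ⟨_, Or.inl rfl, s.homeo.symm x, hx, s.homeo.apply_symm_apply x⟩)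
  change ∀ x ∈ ⋃₀ s.right, e x = x at he
  change ∀ x, dist x (e x) ≤ _ ∧ dist (s.homeo.symm x) (s.homeo.symm (e x)) ≤ _ at hedist
  change ∀ L ∈ E.pieces, L ∉ s.right → _ at heL
  have hfind : ∀ K : 𝒜, ∃ L ∈ E.nontrivialPieces, (e.trans s.homeo.symm) '' L ⊆ U' K := by
    intro K
    obtain ⟨x, hx⟩ := D.nonempty' K (h𝒜 K.2).1
    have hxU := hgK K K.2 (mem_image_of_mem g hx)
    obtain ⟨L, hL, hwL⟩ := E.covers (e.symm (s.homeo (g x)))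
    have hLs : L ∉ s.right := by
      intro hLr
      have h1 := he _ ⟨L, hLr, hwL⟩
      rw [e.apply_symm_apply] at h1
      have h2 : s.homeo (g x) ∈ ⋃₀ s.right := h1 ▸ ⟨L, hLr, hwL⟩
      exact hOM K K.2 (hUO' K hxU) (s.apply_mem_iff.1 h2)
    have hLU : L ⊆ (e.trans s.homeo.symm) ⁻¹' U' K := by
      obtain ⟨v, hv, hLv⟩ := heL L hL hLs
      have hgv : s.homeo (g x) ∈ v := hLv ⟨_, hwL, e.apply_symm_apply _⟩
      obtain rfl | ⟨K', rfl⟩ := hv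
      · obtain ⟨z, hz, hzx⟩ := hgv
        rw [s.homeo.injective.eq_iff] at hzx
        exact absurd (hzx ▸ mem_image_of_mem g ⟨K, K.2, hx⟩) hz
      · obtain ⟨z, hz, hzx⟩ := hgv
        rw [s.homeo.injective.eq_iff] at hzx
        have hKK : K' = K := Subtype.ext
          (hO.eq_of_mem K'.2 K.2 (hUO' K' (hzx ▸ hz)) (hUO' K hxU))
        intro y hy
        obtain ⟨z', hz', hzy⟩ := hLv (mem_image_of_mem e hy)
        rw [mem_preimage, Homeomorph.trans_apply, ← hzy, s.homeo.symm_apply_apply, ← hKK]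
        exact hz'
    obtain ⟨u, hu, hsat, hLu, huU⟩ := hE.1.exists_saturated hL
      ((hU' K).preimage (e.trans s.homeo.symm).continuous) hLU
    obtain ⟨L', hL', hnd, hLu'⟩ := hEd.exists_nondeg_subset hu hsat ((E.nonempty' L hL).mono hLu)
    exact ⟨L', ⟨hL', hnd⟩, image_subset_iff.2 (hLu'.trans huU)⟩
  choose L hL hLU using hfind
  choose f' hf'O hf'L using fun K : 𝒜 ↦ hshift' K _
    (h𝒦.2.1 (e.trans s.homeo.symm) (L K) (hE.2.2 _ (hL K).1 (hL K).2)) (hLU K)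
  let f : Set X → X ≃ₜ X := fun K ↦ if hK : K ∈ 𝒜 then f' ⟨K, hK⟩ else Homeomorph.refl X
  have hfK : ∀ K (hK : K ∈ 𝒜), f K = f' ⟨K, hK⟩ := fun K hK ↦ dif_pos hK
  have hfs : ∀ K ∈ 𝒜, ∀ x ∉ O K, f K x = x := fun K hK ↦ by rw [hfK K hK]; exact hf'O ⟨K, hK⟩
  obtain ⟨φ, hφ, hφid⟩ := exists_glue hO f hfs
  have hφdist : ∀ x, dist x (φ x) ≤ 3 * ε ∧ dist (s.homeo x) (s.homeo (φ x)) ≤ 3 * ε := by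
    intro x
    by_cases hx : ∃ K ∈ 𝒜, x ∈ O K
    · obtain ⟨K, hK, hxK⟩ := hx
      rw [hφ K hK x hxK]
      exact hOdist K hK x hxK _ (((f K).mem_of_supported (hfs K hK)).2 hxK)
    · push Not at hx
      rw [hφid x hx, dist_self, dist_self]
      constructor <;> positivity
  obtain ⟨t, ht, htl, hst⟩ := s.exists_extend (φ.trans (s.homeo.trans e.symm)) (by
      intro x hx
      simp only [Homeomorph.trans_apply]
      rw [hφid x fun K hK hxK ↦ hOM K hK hxK hx, e.symm_apply_eq, he _ (s.apply_mem hx)])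
    h𝒜 hd (by
      intro K hK
      have h1 : ⇑φ '' K = (e.trans s.homeo.symm) '' L ⟨K, hK⟩ := by
        rw [← hf'L ⟨K, hK⟩, ← hfK K hK]
        exact image_congr fun x hx ↦ hφ K hK x ((hKO K hK).1 hx)
      change ⇑(s.homeo.trans e.symm) ∘ ⇑φ '' K ∈ _
      rw [image_comp, h1, ← image_comp]
      convert hL ⟨K, hK⟩
      rw [← image_id (L ⟨K, hK⟩), ← image_comp]
      refine image_congr fun x _ ↦ ?_
      simp)
  refine ⟨t, hst, htl ▸ subset_union_right, fun x ↦ ?_, fun x ↦ ?_⟩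
  · rw [ht]
    have h1 := (hφdist x).2
    have h2 := (hedist (e.symm (s.homeo (φ x)))).1
    rw [e.apply_symm_apply, dist_comm] at h2
    have h3 := dist_triangle (s.homeo x) (s.homeo (φ x)) (e.symm (s.homeo (φ x)))
    change dist (s.homeo x) (e.symm (s.homeo (φ x))) ≤ _
    linarith
  · rw [ht]
    have h1 := (hφdist (φ.symm (s.homeo.symm (e x)))).1
    rw [φ.apply_symm_apply, dist_comm] at h1
    have h2 := (hedist x).2
    have h3 := dist_triangle (s.homeo.symm x) (s.homeo.symm (e x))
      (φ.symm (s.homeo.symm (e x)))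
    change dist (s.homeo.symm x) (φ.symm (s.homeo.symm (e x))) ≤ _
    linarith

end Matching

/-! ### Equivalence of dense tame decompositions -/

/-- The limit of a uniformly Cauchy sequence of homeomorphisms whose inverses are also uniformly
Cauchy. -/
lemma exists_homeomorph_tendsto {X : Type*} [MetricSpace X] [CompleteSpace X] (Φ : ℕ → X ≃ₜ X)
    (C : ℝ) (h : ∀ n x, dist (Φ n x) (Φ (n + 1) x) ≤ C * (1 / 2) ^ n)
    (h' : ∀ n x, dist ((Φ n).symm x) ((Φ (n + 1)).symm x) ≤ C * (1 / 2) ^ n) :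
    ∃ F : X ≃ₜ X, ∀ x, Filter.Tendsto (fun n ↦ Φ n x) Filter.atTop (𝓝 (F x)) := by
  have key : ∀ f : ℕ → X → X, (∀ n, Continuous (f n)) →
      (∀ n x, dist (f n x) (f (n + 1) x) ≤ C * (1 / 2) ^ n) →
      ∃ F : X → X, Continuous F ∧ TendstoUniformly f F Filter.atTop := by
    intro f hf hC
    have hlt : (1 / 2 : ℝ) < 1 := by norm_num
    choose F hF using fun x ↦ cauchySeq_tendsto_of_complete
      (cauchySeq_of_le_geometric _ C hlt (fun n ↦ hC n x))
    have hu : TendstoUniformly f F Filter.atTop := by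
      rw [Metric.tendstoUniformly_iff]
      intro ε hε
      have hlim : Filter.Tendsto (fun n : ℕ ↦ C * (1 / 2 : ℝ) ^ n / (1 - 1 / 2)) Filter.atTop
          (𝓝 (C * 0 / (1 - 1 / 2))) :=
        ((tendsto_pow_atTop_nhds_zero_of_lt_one (by norm_num) hlt).const_mul C).div_const _
      rw [mul_zero, zero_div] at hlim
      filter_upwards [hlim.eventually_lt_const hε] with n hn x
      rw [dist_comm]
      exact (dist_le_of_le_geometric_of_tendsto _ C hlt (fun n ↦ hC n x) (hF x) n).trans_lt hn
    exact ⟨F, hu.continuous (Filter.Eventually.of_forall hf).frequently, hu⟩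
  obtain ⟨F, hFc, hF⟩ := key (fun n ↦ Φ n) (fun n ↦ (Φ n).continuous) h
  obtain ⟨G, hGc, hG⟩ := key (fun n ↦ (Φ n).symm) (fun n ↦ (Φ n).symm.continuous) h'
  refine ⟨⟨⟨F, G, fun x ↦ ?_, fun x ↦ ?_⟩, hFc, hGc⟩, fun x ↦ hF.tendsto_at x⟩
  · refine tendsto_nhds_unique (hG.tendsto_comp hGc.continuousAt (hF.tendsto_at x)) ?_
    simp only [Homeomorph.symm_apply_apply, tendsto_const_nhds]
  · refine tendsto_nhds_unique (hF.tendsto_comp hFc.continuousAt (hG.tendsto_at x)) ?_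
    simp only [Homeomorph.apply_symm_apply, tendsto_const_nhds]

namespace Matching

variable {X : Type*} [MetricSpace X] {D E : Decomposition X} {𝒦 : Set (Set X)}

/-- Match all large pieces of `D`. -/
lemma exists_match_large (h𝒦 : IsTameFamily 𝒦) (hD : D.KTame 𝒦) (hE : E.KTame 𝒦)
    (hEd : E.IsDenseDecomp) (s : Matching D E) {ε η : ℝ} (hη : 0 < η) (hε : 0 < ε)
    (hf : s.Fine ε ε) (hf' : s.symm.Fine ε ε) :
    ∃ t : Matching D E, s.Le t ∧ s.Close t (5 * ε) (5 * ε) ∧ t.Fine η (ε + 2 * (5 * ε)) := by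
  obtain ⟨t, hst, hAt, hclose⟩ := s.exists_match h𝒦 hD hE hEd
    (𝒜 := {K ∈ {A ∈ D.pieces | ∃ a ∈ A, ∃ b ∈ A, η < dist a b} | K ∉ s.left})
    (fun K hK ↦ by
      obtain ⟨⟨hKD, a, ha, b, hb, hab⟩, -⟩ := hK
      refine ⟨hKD, fun hsub ↦ ?_⟩
      rw [hsub ha hb, dist_self] at hab
      exact hη.not_gt hab)
    (fun K hK ↦ hK.2) ((hD.1.discreteOn_large hη).mono fun K hK ↦ hK.1) hε hf hf'
  refine ⟨t, hst, hclose, fun K hK hKt x hx y hy ↦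
    ⟨?_, (hf.of_close hclose hst.left_subset K hK hKt x hx y hy).2⟩⟩
  by_contra! hlt
  exact hKt (hAt ⟨⟨hK, x, hx, y, hy, hlt⟩, fun hKs ↦ hKt (hst.left_subset hKs)⟩)

lemma exists_refine (h𝒦 : IsTameFamily 𝒦) (hD : D.KTame 𝒦) (hE : E.KTame 𝒦)
    (hDd : D.IsDenseDecomp) (hEd : E.IsDenseDecomp) (s : Matching D E) {ε η : ℝ} (hη : 0 < η)
    (hηε : η ≤ ε) (hf : s.Fine ε ε) (hf' : s.symm.Fine ε ε) :
    ∃ t : Matching D E, s.Le t ∧ s.Close t (200 * ε) (200 * ε) ∧ t.Fine (7 * η) (7 * η) ∧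
      t.symm.Fine (7 * η) (7 * η) := by
  have hε := hη.trans_le hηε
  obtain ⟨t, hst, hstc, htf⟩ := s.exists_match_large h𝒦 hD hE hEd hη hε hf hf'
  have htf' := hf'.of_close hstc.symm hst.right_subset
  obtain ⟨u, htu, htuc, huf⟩ := t.symm.exists_match_large h𝒦 hE hD hDd (ε := 11 * ε) hη
    (by positivity) (htf'.mono (by linarith) (by linarith)) (htf.mono (by linarith) (by linarith))
  have huf' := htf.of_close htuc.symm htu.right_subset
  obtain ⟨v, huv, hvf, huvc⟩ := u.symm.exists_shrink hD.1 hD.2.1 (a := η) (b := 121 * ε) hη.le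
    (by positivity) hη (huf'.mono le_rfl (by linarith))
  have hvf' := huf.of_close huvc.symm huv.right_subset
  obtain ⟨w, hvw, hwf, hvwc⟩ := v.symm.exists_shrink hE.1 hE.2.1 (a := η) (b := 127 * ε) hη.le
    (by positivity) hη (hvf'.mono le_rfl (by linarith))
  have hwf' := hvf.of_close hvwc.symm hvw.right_subset
  have hsw := ((hstc.trans htuc.symm).trans huvc).trans hvwc.symm
  refine ⟨w.symm, ((hst.trans htu.symm).trans huv).trans hvw.symm,
    ⟨fun x ↦ (hsw.1 x).trans (by linarith), fun x ↦ (hsw.2 x).trans (by linarith)⟩,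
    hwf'.mono (by linarith) (by linarith), hwf.mono (by linarith) (by linarith)⟩

end Matching

theorem Decomposition.KTame.exists_equiv {X : Type*} [MetricSpace X] [CompleteSpace X]
    (hbdd : ∀ x y : X, dist x y ≤ 1) {𝒦 : Set (Set X)} (h𝒦 : IsTameFamily 𝒦)
    {D E : Decomposition X} (hD : D.KTame 𝒦) (hE : E.KTame 𝒦) (hDd : D.IsDenseDecomp)
    (hEd : E.IsDenseDecomp) :
    ∃ F : X ≃ₜ X, (∀ K ∈ D.nontrivialPieces, ⇑F '' K ∈ E.nontrivialPieces) ∧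
      ∀ L ∈ E.nontrivialPieces, ∃ K ∈ D.nontrivialPieces, ⇑F '' K = L := by
  let State (n : ℕ) := {s : Matching D E // s.Fine ((1 / 2) ^ n) ((1 / 2) ^ n) ∧
    s.symm.Fine ((1 / 2) ^ n) ((1 / 2) ^ n)}
  have hstep : ∀ (n : ℕ) (s : State n), ∃ t : State (n + 1), s.1.Le t.1 ∧
      s.1.Close t.1 (200 * (1 / 2) ^ n) (200 * (1 / 2) ^ n) := by
    rintro n ⟨s, hs, hs'⟩
    have hpos : (0 : ℝ) < (1 / 2) ^ n := by positivity
    obtain ⟨t, ht, hc, hf, hf'⟩ := s.exists_refine h𝒦 hD hE hDd hEd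
      (η := (1 / 2) ^ (n + 1) / 7) (by positivity) (by rw [pow_succ]; linarith) hs hs'
    rw [mul_div_cancel₀ _ (by norm_num)] at hf hf'
    exact ⟨⟨t, hf, hf'⟩, ht, hc⟩
  choose next hle hclose using hstep
  have hempty : ∀ 𝒜 : Set (Set X), 𝒜 = ∅ → DiscreteOn univ 𝒜 := by
    rintro _ rfl x -
    exact ⟨univ, Filter.univ_mem, fun A hA ↦ hA.elim⟩
  let s : (n : ℕ) → State n := fun n ↦ Nat.rec (motive := State)
    ⟨⟨Homeomorph.refl X, ∅, ∅, empty_subset _, empty_subset _, hempty _ rfl, hempty _ rfl,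
      fun _ h ↦ h.elim, fun _ h ↦ h.elim⟩, fun _ _ _ x _ y _ ↦ by simpa using hbdd x y,
      fun _ _ _ x _ y _ ↦ by
        rw [pow_zero]
        exact ⟨hbdd _ _, hbdd _ _⟩⟩ (fun n s ↦ next n s) n
  have hmono : ∀ n m, n ≤ m → (s n).1.Le (s m).1 := by
    intro n m hnm
    induction m, hnm using Nat.le_induction with
    | base => exact Matching.Le.refl _
    | succ m _ ih => exact ih.trans (hle m (s m))
  obtain ⟨F, hF⟩ := exists_homeomorph_tendsto (fun n ↦ (s n).1.homeo) 200
    (fun n ↦ (hclose n (s n)).1) (fun n ↦ (hclose n (s n)).2)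
  have hFs : ∀ n, EqOn F (s n).1.homeo (⋃₀ (s n).1.left) := fun n x hx ↦
    tendsto_nhds_unique (hF x) (tendsto_const_nhds.congr' (by
      filter_upwards [Filter.eventually_ge_atTop n] with m hm
      exact ((hmono n m hm).eqOn hx).symm))
  have hlim : Filter.Tendsto (fun n : ℕ ↦ (1 / 2 : ℝ) ^ n) Filter.atTop (𝓝 0) :=
    tendsto_pow_atTop_nhds_zero_of_lt_one (by norm_num) (by norm_num)
  have hex : ∀ K : Set X, ¬ K.Subsingleton → ∃ n, ∃ x ∈ K, ∃ y ∈ K,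
      (1 / 2 : ℝ) ^ n < dist x y := by
    intro K hK
    rw [not_subsingleton_iff] at hK
    obtain ⟨x, hx, y, hy, hxy⟩ := hK
    obtain ⟨n, hn⟩ := (hlim.eventually_lt_const (dist_pos.2 hxy)).exists
    exact ⟨n, x, hx, y, hy, hn⟩
  refine ⟨F, fun K hK ↦ ?_, fun L hL ↦ ?_⟩
  · obtain ⟨n, x, hx, y, hy, hxy⟩ := hex K hK.2
    have hKn : K ∈ (s n).1.left := by
      by_contra hKn
      exact (((s n).2.1 K hK.1 hKn x hx y hy).1.trans_lt hxy).false
    rw [image_congr fun x hx ↦ hFs n ⟨K, hKn, hx⟩]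
    exact (s n).1.right_subset ((s n).1.image_mem K hKn)
  · obtain ⟨n, x, hx, y, hy, hxy⟩ := hex L hL.2
    have hLn : L ∈ (s n).1.right := by
      by_contra hLn
      exact (((s n).2.2 L hL.1 hLn x hx y hy).1.trans_lt hxy).false
    have hKn := (s n).1.symm_image_mem L hLn
    refine ⟨_, (s n).1.left_subset hKn, ?_⟩
    rw [image_congr fun x hx ↦ hFs n ⟨_, hKn, hx⟩, ← image_comp,
      (s n).1.homeo.self_comp_symm, image_id]

/-! ### Spongy sets -/

lemma IsTameFamily.interior_eq_empty {X : Type*} [TopologicalSpace X] {𝒦 : Set (Set X)}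
    (h𝒦 : IsTameFamily 𝒦) (hnt : ∀ K ∈ 𝒦, ¬ K.Subsingleton) {A : Set X}
    (hA : A.Subsingleton) : interior A = ∅ := by
  by_contra hne
  obtain ⟨K, hK, hKA⟩ := h𝒦.2.2.2.2 _ isOpen_interior (nonempty_iff_ne_empty.2 hne)
  exact hnt K hK (hA.anti (hKA.trans interior_subset))

lemma IsTameFamily.mem_iUnion_interior {X : Type*} [TopologicalSpace X] {𝒦 : Set (Set X)}
    (h𝒦 : IsTameFamily 𝒦) (hnt : ∀ K ∈ 𝒦, ¬ K.Subsingleton) {D : Decomposition X} {x : X} :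
    x ∈ ⋃ A ∈ D.pieces, interior A ↔ ∃ A ∈ D.nontrivialPieces, x ∈ interior A := by
  simp only [mem_iUnion, exists_prop]
  refine ⟨fun ⟨A, hA, hx⟩ ↦ ⟨A, ⟨hA, fun hs ↦ ?_⟩, hx⟩, fun ⟨A, hA, hx⟩ ↦ ⟨A, hA.1, hx⟩⟩
  rw [h𝒦.interior_eq_empty hnt hs] at hx
  exact hx

lemma IsKSpongy.exists_homeomorph {X : Type*} [MetricSpace X] [CompleteSpace X]
    (hbdd : ∀ x y : X, dist x y ≤ 1) {𝒦 : Set (Set X)} (h𝒦 : IsTameFamily 𝒦)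
    (hnt : ∀ K ∈ 𝒦, ¬ K.Subsingleton) {S S' : Set X} (hS : IsKSpongy 𝒦 S)
    (hS' : IsKSpongy 𝒦 S') : ∃ F : X ≃ₜ X, ⇑F '' S = S' := by
  obtain ⟨D, hD, hDd, hDS⟩ := hS
  obtain ⟨E, hE, hEd, hES⟩ := hS'
  obtain ⟨F, hF, hF'⟩ := hD.exists_equiv hbdd h𝒦 hE hDd hEd
  have hmem : ∀ x, F x ∈ S'ᶜ ↔ x ∈ Sᶜ := by
    intro x
    rw [hDS, hES, h𝒦.mem_iUnion_interior hnt, h𝒦.mem_iUnion_interior hnt]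
    constructor
    · rintro ⟨L, hL, hx⟩
      obtain ⟨K, hK, rfl⟩ := hF' L hL
      rw [← F.image_interior, F.injective.mem_set_image] at hx
      exact ⟨K, hK, hx⟩
    · rintro ⟨K, hK, hx⟩
      exact ⟨_, hF K hK, by rwa [← F.image_interior, F.injective.mem_set_image]⟩
  refine ⟨F, Subset.antisymm ?_ fun y hy ↦ ⟨F.symm y, ?_, F.apply_symm_apply y⟩⟩
  · rintro _ ⟨x, hx, rfl⟩
    by_contra h
    exact (hmem x).1 h hx
  · by_contra h
    have := (hmem _).2 h
    rw [F.apply_symm_apply] at this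
    exact this hy

lemma IsKSpongy.isNowhereDense {X : Type*} [MetricSpace X] {𝒦 : Set (Set X)}
    (hint : ∀ K ∈ 𝒦, (interior K).Nonempty) {S : Set X} (hS : IsKSpongy 𝒦 S) :
    IsNowhereDense S := by
  obtain ⟨D, hD, hDd, hDS⟩ := hS
  have hSc : IsClosed S := by
    rw [← isOpen_compl_iff, hDS]
    exact isOpen_biUnion fun A _ ↦ isOpen_interior
  have hmeet : ∀ A ∈ D.pieces, ∀ W ⊆ S, (interior A ∩ W).Nonempty → False := by
    rintro A hA W hWS ⟨x, hxA, hxW⟩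
    have : x ∈ Sᶜ := by
      rw [hDS]
      exact mem_biUnion hA hxA
    exact this (hWS hxW)
  have hsub : ∀ A ∈ D.pieces, ∀ W ⊆ S, IsOpen W → A ⊆ W → False := by
    intro A hA W hWS hW hAW
    obtain ⟨u, hu, hsat, hAu, huW⟩ := hD.1.exists_saturated hA hW hAW
    obtain ⟨B, hB, hBn, hBu⟩ := hDd.exists_nondeg_subset hu hsat ((D.nonempty' A hA).mono hAu)
    obtain ⟨x, hx⟩ := hint B (hD.2.2 B hB hBn)
    exact hmeet B hB W hWS ⟨x, hx, huW (hBu (interior_subset hx))⟩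
  rw [hSc.isNowhereDense_iff, ← not_nonempty_iff_eq_empty]
  rintro ⟨x, hx⟩
  obtain ⟨A, hA, hxA⟩ := D.covers x
  obtain ⟨V, hV, hVW, hVD⟩ := hD.1.exists_nhds x (isOpen_interior.mem_nhds hx)
  by_cases hVA : V ⊆ A
  · exact hmeet A hA _ interior_subset ⟨x, mem_interior_iff_mem_nhds.2
      (Filter.mem_of_superset hV hVA), hx⟩
  · rw [not_subset] at hVA
    obtain ⟨y, hyV, hyA⟩ := hVA
    obtain ⟨B, hB, hyB⟩ := D.covers y
    exact hsub B hB _ interior_subset isOpen_interior (hVD B hB ⟨y, hyB, hyV⟩ fun hxB ↦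
      hyA (D.eq_of_mem hB hA hxB hxA ▸ hyB))

/-! ### A criterion of strong shrinkability -/

lemma Decomposition.Vanishing.stronglyShrinkable {X : Type*} [MetricSpace X]
    {D : Decomposition X} (hv : D.Vanishing)
    (hD : ∀ K ∈ D.nontrivialPieces, ∀ δ : ℝ, 0 < δ → ∃ (O : Set X) (h : X ≃ₜ X), IsOpen O ∧
      D.Saturated O ∧ K ⊆ O ∧ (∀ x ∈ O, ∃ k ∈ K, dist x k < δ) ∧ (∀ x ∉ O, h x = x) ∧
      ∀ L ∈ D.pieces, L ⊆ O → ∀ x ∈ L, ∀ y ∈ L, dist (h x) (h y) ≤ δ) :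
    D.StronglyShrinkable := by
  intro U hU hUs 𝒰 h𝒰 hU𝒰 𝒱 h𝒱 hU𝒱
  let ℬ : Set (Set X) := {K ∈ D.pieces | K ⊆ U ∧ ∀ v ∈ 𝒱, ¬ K ⊆ v}
  have hℬd : DiscreteOn U ℬ := by
    intro x hx
    obtain ⟨v, hv𝒱, hxv⟩ := hU𝒱 hx
    obtain ⟨V, hV, -, hVA⟩ := hv.exists_nhds x ((h𝒱 v hv𝒱).1.mem_nhds hxv)
    refine ⟨V, hV, fun A hA hne ↦ ?_⟩
    by_contra hxA
    exact hA.2.2 v hv𝒱 (hVA A hA.1 hne hxA)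
  have hℬn : ∀ K ∈ ℬ, K ∈ D.nontrivialPieces := by
    refine fun K hK ↦ ⟨hK.1, fun hs ↦ ?_⟩
    obtain ⟨x, hx⟩ := D.nonempty' K hK.1
    obtain ⟨v, hv𝒱, hxv⟩ := hU𝒱 (hK.2.1 hx)
    exact hK.2.2 v hv𝒱 fun y hy ↦ hs hx hy ▸ hxv
  have hN : ∀ K, ∃ u, K ∈ ℬ → u ∈ 𝒰 ∧ K ⊆ u := by
    intro K
    by_cases hK : K ∈ ℬ
    · obtain ⟨x, hx⟩ := D.nonempty' K hK.1
      obtain ⟨u, hu, hxu⟩ := hU𝒰 (hK.2.1 hx)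
      exact ⟨u, fun _ ↦ ⟨hu, (h𝒰 u hu).2.2 K hK.1 hK.2.1 ⟨x, hx, hxu⟩⟩⟩
    · exact ⟨univ, fun h ↦ absurd h hK⟩
  choose N hN using hN
  obtain ⟨O, hO, hKO⟩ := hℬd.exists_separatedOn hU
    (fun A hA B hB ↦ D.disjoint' A hA.1 B hB.1) (fun A hA ↦ hA.2.1) N
    fun K hK ↦ ⟨(h𝒰 _ (hN K hK).1).1, (hN K hK).2⟩
  have hshr : ∀ K, ∃ (O' : Set X) (h : X ≃ₜ X), K ∈ ℬ → IsOpen O' ∧ O' ⊆ O K ∧ D.Saturated O' ∧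
      K ⊆ O' ∧ (∀ x ∉ O', h x = x) ∧ ∀ L ∈ D.pieces, L ⊆ O' → ∃ v ∈ 𝒱, ⇑h '' L ⊆ v := by
    intro K
    by_cases hK : K ∈ ℬ
    · obtain ⟨δ, hδ, hδv⟩ := lebesgue_number_lemma_of_metric_sUnion
        (c := (fun v ↦ v ∩ O K) '' 𝒱) (D.isCompact' K hK.1) (by
          rintro _ ⟨v, hv𝒱, rfl⟩
          exact (h𝒱 v hv𝒱).1.inter (hO.1 K hK).1) (by
          intro x hx
          obtain ⟨v, hv𝒱, hxv⟩ := hU𝒱 (hK.2.1 hx)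
          exact ⟨_, ⟨v, hv𝒱, rfl⟩, hxv, (hKO K hK).1 hx⟩)
      obtain ⟨O', h, hO', hsat, hKO', hO'δ, hh, hL⟩ := hD K (hℬn K hK) (δ / 2) (half_pos hδ)
      refine ⟨O', h, fun _ ↦ ⟨hO', fun x hx ↦ ?_, hsat, hKO', hh, fun L hLD hLO ↦ ?_⟩⟩
      · obtain ⟨k, hk, hxk⟩ := hO'δ x hx
        obtain ⟨_, ⟨v, -, rfl⟩, hkv⟩ := hδv k hk
        exact (hkv (Metric.mem_ball.2 (by linarith))).2
      · obtain ⟨l, hl⟩ := D.nonempty' L hLD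
        obtain ⟨k, hk, hlk⟩ := hO'δ _ ((h.mem_of_supported hh).2 (hLO hl))
        obtain ⟨_, ⟨v, hv𝒱, rfl⟩, hkv⟩ := hδv k hk
        refine ⟨v, hv𝒱, ?_⟩
        rintro _ ⟨x, hx, rfl⟩
        refine (hkv (Metric.mem_ball.2 ?_)).1
        linarith [hL L hLD hLO x hx l hl, dist_triangle (h x) (h l) k]
    · exact ⟨univ, Homeomorph.refl X, fun h ↦ absurd h hK⟩
  choose O' h hOh using hshr
  have hO' : SeparatedOn U ℬ O' := hO.shrink fun K hK ↦ ⟨(hOh K hK).1, (hOh K hK).2.1⟩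
  have hh : ∀ K ∈ ℬ, ∀ x ∉ O' K, h K x = x := fun K hK ↦ (hOh K hK).2.2.2.2.1
  refine ⟨glueHomeomorph hO' h hh, fun x hx ↦ ?_, fun A hA hAU ↦ ?_⟩
  · beta_reduce at hx ⊢
    rw [glueHomeomorph_apply] at hx ⊢
    by_cases hex : ∃ K ∈ ℬ, (x : X) ∈ O' K
    · obtain ⟨K, hK, hxK⟩ := hex
      have hsub := (hOh K hK).2.1.trans (hKO K hK).2
      rw [glueMap_of_mem hO' (fun K ↦ h K) hK hxK]
      exact ⟨N K, (hN K hK).1, hsub (((h K).mem_of_supported (hh K hK)).2 hxK), hsub hxK⟩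
    · push Not at hex
      exact absurd (glueMap_of_notMem (fun K ↦ h K) hex) hx
  · by_cases hex : ∃ K ∈ ℬ, (A ∩ O' K).Nonempty
    · obtain ⟨K, hK, hne⟩ := hex
      have hAO := (hOh K hK).2.2.1 A hA hne
      obtain ⟨v, hv𝒱, hAv⟩ := (hOh K hK).2.2.2.2.2 A hA hAO
      refine ⟨v, hv𝒱, ?_⟩
      rintro _ ⟨_, ⟨x, hx, rfl⟩, rfl⟩
      beta_reduce
      rw [glueHomeomorph_apply, glueMap_of_mem hO' (fun K ↦ h K) hK (hAO hx)]
      exact hAv (mem_image_of_mem _ hx)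
    · push Not at hex
      have hAℬ : A ∉ ℬ := fun hAB ↦ by
        obtain ⟨x, hx⟩ := D.nonempty' A hA
        exact (hex A hAB).subset ⟨hx, (hOh A hAB).2.2.2.1 hx⟩
      obtain ⟨v, hv𝒱, hAv⟩ : ∃ v ∈ 𝒱, A ⊆ v := by
        by_contra! hcon
        exact hAℬ ⟨hA, hAU, hcon⟩
      refine ⟨v, hv𝒱, ?_⟩
      rintro _ ⟨_, ⟨x, hx, rfl⟩, rfl⟩
      beta_reduce
      rw [glueHomeomorph_apply, glueMap_of_notMem (fun K ↦ h K)
        fun K hK hxK ↦ (hex K hK).subset ⟨hx, hxK⟩]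
      exact hAv hx

/-! ### Construction of dense tame decompositions -/

lemma exists_maximal_separated {X : Type*} [MetricSpace X] (S : Set X) (η : ℝ) :
    ∃ Z ⊆ S, Z.Pairwise (fun x y ↦ η ≤ dist x y) ∧ ∀ x ∈ S, x ∉ Z → ∃ z ∈ Z, dist x z < η := by
  obtain ⟨Z, hZ⟩ := zorn_subset {Z : Set X | Z ⊆ S ∧ Z.Pairwise fun x y ↦ η ≤ dist x y}
    (fun c hc hchain ↦ ⟨⋃₀ c, ⟨sUnion_subset fun Z hZ ↦ (hc hZ).1,
      (pairwise_sUnion hchain.directedOn).2 fun Z hZ ↦ (hc hZ).2⟩,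
      fun Z hZ ↦ subset_sUnion_of_mem hZ⟩)
  refine ⟨Z, hZ.prop.1, hZ.prop.2, fun x hx hxZ ↦ ?_⟩
  by_contra! hfar
  refine hxZ (hZ.le_of_ge ⟨insert_subset hx hZ.prop.1, hZ.prop.2.insert fun y hy _ ↦
    ⟨hfar y hy, ?_⟩⟩ (subset_insert x Z) (mem_insert x Z))
  rw [dist_comm]
  exact hfar y hy

/-- A step of the construction of a dense tame decomposition: a discrete family of pieces off
`C`, and a rich family of open sets which further pieces are required to lie in. -/
structure PieceStage {X : Type*} [TopologicalSpace X] (𝒦 : Set (Set X)) (C : Set X) where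
  /-- the pieces chosen so far -/
  pieces : Set (Set X)
  /-- the open sets allowed for further pieces -/
  allowed : Set (Set X)
  pieces_subset : pieces ⊆ 𝒦
  disjoint : ∀ A ∈ pieces, ∀ B ∈ pieces, A ≠ B → Disjoint A B
  discrete : DiscreteOn univ pieces
  disjoint_set : ∀ A ∈ pieces, Disjoint A C
  isOpen_allowed : ∀ W ∈ allowed, IsOpen W
  disjoint_allowed : ∀ W ∈ allowed, Disjoint W C
  allowed_mono : ∀ W ∈ allowed, ∀ W' ⊆ W, IsOpen W' → W' ∈ allowed
  exists_allowed : ∀ U : Set X, IsOpen U → U.Nonempty → ∃ W ∈ allowed, W ⊆ U ∧ W.Nonempty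

namespace PieceStage

variable {X : Type*} [MetricSpace X] {𝒦 : Set (Set X)} {C : Set X}

/-- `t` refines `s` at scale `η`. -/
structure Refines (s t : PieceStage 𝒦 C) (η : ℝ) : Prop where
  pieces_subset : s.pieces ⊆ t.pieces
  allowed_subset : t.allowed ⊆ s.allowed
  exists_of_new : ∀ K ∈ t.pieces, K ∉ s.pieces → ∃ W ∈ t.allowed, K ⊆ W
  dist_le : ∀ W ∈ t.allowed, ∀ x ∈ W, ∀ y ∈ W, dist x y ≤ η
  dense : ∀ x, ∃ K ∈ t.pieces, ∃ y ∈ K, dist x y ≤ 2 * η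
  exists_shrink : ∀ K ∈ s.pieces, ∃ (O : Set X) (h : X ≃ₜ X), IsOpen O ∧ K ⊆ O ∧
    (∀ x ∈ O, ∃ k ∈ K, dist x k < η) ∧ (∀ x ∉ O, h x = x) ∧
    (∀ L ∈ s.pieces, L ≠ K → Disjoint L O) ∧ (∀ x ∈ K, ∀ y ∈ K, dist (h x) (h y) ≤ η) ∧
    ∀ W ∈ t.allowed, (W ⊆ O ∨ Disjoint W O) ∧ ∀ x ∈ W, ∀ y ∈ W, dist (h x) (h y) ≤ η

/-- The shrinking homeomorphisms for the pieces of `s`, and a rich family of small open sets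
adapted to them. -/
lemma exists_allowed_shrink (h𝒦 : IsTameFamily 𝒦) (s : PieceStage 𝒦 C) {η : ℝ} (hη : 0 < η) :
    ∃ 𝒲 ⊆ s.allowed, (∀ W ∈ 𝒲, ∀ W' ⊆ W, IsOpen W' → W' ∈ 𝒲) ∧
      (∀ U : Set X, IsOpen U → U.Nonempty → ∃ W ∈ 𝒲, W ⊆ U ∧ W.Nonempty) ∧
      (∀ W ∈ 𝒲, ∀ x ∈ W, ∀ y ∈ W, dist x y ≤ η) ∧
      ∀ K ∈ s.pieces, ∃ (O : Set X) (h : X ≃ₜ X), IsOpen O ∧ K ⊆ O ∧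
        (∀ x ∈ O, ∃ k ∈ K, dist x k < η) ∧ (∀ x ∉ O, h x = x) ∧
        (∀ L ∈ s.pieces, L ≠ K → Disjoint L O) ∧ (∀ x ∈ K, ∀ y ∈ K, dist (h x) (h y) ≤ η) ∧
        ∀ W ∈ 𝒲, (W ⊆ O ∨ Disjoint W O) ∧ ∀ x ∈ W, ∀ y ∈ W, dist (h x) (h y) ≤ η := by
  obtain ⟨O, hO, hKO⟩ := s.discrete.exists_separatedOn isOpen_univ s.disjoint
    (fun A _ ↦ subset_univ A) (fun K ↦ ⋃ k ∈ K, Metric.ball k η) (fun K _ ↦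
      ⟨isOpen_biUnion fun k _ ↦ Metric.isOpen_ball, fun k hk ↦
        mem_biUnion hk (Metric.mem_ball_self hη)⟩)
  have hball : ∀ (x y z : X), x ∈ Metric.ball z (η / 2) → y ∈ Metric.ball z (η / 2) →
      dist x y ≤ η := by
    intro x y z hx hy
    rw [Metric.mem_ball] at hx hy
    linarith [dist_triangle_right x y z]
  have hsh : ∀ K, ∃ h : X ≃ₜ X, K ∈ s.pieces → (∀ x ∉ O K, h x = x) ∧
      ∀ x ∈ K, ∀ y ∈ K, dist (h x) (h y) ≤ η := by
    intro K
    by_cases hK : K ∈ s.pieces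
    · obtain ⟨h, hh, v, ⟨y, hy, rfl⟩, hv⟩ := h𝒦.2.2.1 K (s.pieces_subset hK) (O K)
        (hO.1 K hK).1 (hKO K hK).1 ((fun y ↦ Metric.ball y (η / 2) ∩ O K) '' O K) (by
          rintro _ ⟨y, -, rfl⟩
          exact ⟨Metric.isOpen_ball.inter (hO.1 K hK).1, inter_subset_right⟩) (fun y hy ↦
          ⟨_, ⟨y, hy, rfl⟩, Metric.mem_ball_self (half_pos hη), hy⟩)
      exact ⟨h, fun _ ↦ ⟨hh, fun x hx z hz ↦ hball _ _ y (hv (mem_image_of_mem h hx)).1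
        (hv (mem_image_of_mem h hz)).1⟩⟩
    · exact ⟨Homeomorph.refl X, fun h ↦ absurd h hK⟩
  choose h hh using hsh
  refine ⟨{W ∈ s.allowed | (∀ x ∈ W, ∀ y ∈ W, dist x y ≤ η) ∧ ∀ K ∈ s.pieces,
    (W ⊆ O K ∨ Disjoint W (O K)) ∧ ∀ x ∈ W, ∀ y ∈ W, dist (h K x) (h K y) ≤ η},
    fun W hW ↦ hW.1, ?_, ?_, fun W hW ↦ hW.2.1, ?_⟩
  · rintro W ⟨hW, hWd, hWK⟩ W' hW' hW'o
    exact ⟨s.allowed_mono W hW W' hW' hW'o, fun x hx y hy ↦ hWd x (hW' hx) y (hW' hy),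
      fun K hK ↦ ⟨(hWK K hK).1.imp hW'.trans (Disjoint.mono_left hW'),
        fun x hx y hy ↦ (hWK K hK).2 x (hW' hx) y (hW' hy)⟩⟩
  · intro U hU hne
    obtain ⟨W, hW, hWU, x, hx⟩ := s.exists_allowed U hU hne
    have hWo := s.isOpen_allowed W hW
    have hfix : ∀ K ∈ s.pieces, ∀ W', Disjoint W' (O K) → (∀ x ∈ W', ∀ y ∈ W', dist x y ≤ η) →
        ∀ x ∈ W', ∀ y ∈ W', dist (h K x) (h K y) ≤ η := by
      intro K hK W' hd hW' x hx y hy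
      rw [(hh K hK).1 x (hd.notMem_of_mem_left hx), (hh K hK).1 y (hd.notMem_of_mem_left hy)]
      exact hW' x hx y hy
    by_cases hex : ∃ K ∈ s.pieces, (W ∩ O K).Nonempty
    · obtain ⟨K, hK, y, hyW, hyK⟩ := hex
      let W' := W ∩ (O K ∩ (Metric.ball y (η / 2) ∩ h K ⁻¹' Metric.ball (h K y) (η / 2)))
      have hd : ∀ a ∈ W', ∀ b ∈ W', dist a b ≤ η := fun a ha b hb ↦
        hball a b y ha.2.2.1 hb.2.2.1
      refine ⟨W', ⟨s.allowed_mono W hW W' inter_subset_left (hWo.inter ((hO.1 K hK).1.inter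
        (Metric.isOpen_ball.inter (Metric.isOpen_ball.preimage (h K).continuous)))), hd,
        fun L hL ↦ ?_⟩, inter_subset_left.trans hWU,
        ⟨y, hyW, hyK, Metric.mem_ball_self (half_pos hη), Metric.mem_ball_self (half_pos hη)⟩⟩
      by_cases hLK : L = K
      · subst hLK
        exact ⟨Or.inl fun z hz ↦ hz.2.1, fun a ha b hb ↦ hball _ _ _ ha.2.2.2 hb.2.2.2⟩
      · have hdis : Disjoint W' (O L) := disjoint_left.2 fun z hz hzL ↦
          hLK (hO.eq_of_mem hL hK hzL hz.2.1)
        exact ⟨Or.inr hdis, hfix L hL W' hdis hd⟩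
    · push Not at hex
      have hd : ∀ a ∈ W ∩ Metric.ball x (η / 2), ∀ b ∈ W ∩ Metric.ball x (η / 2),
          dist a b ≤ η := fun a ha b hb ↦ hball a b x ha.2 hb.2
      refine ⟨W ∩ Metric.ball x (η / 2), ⟨s.allowed_mono W hW _ inter_subset_left
        (hWo.inter Metric.isOpen_ball), hd, fun K hK ↦ ?_⟩, inter_subset_left.trans hWU,
        ⟨x, hx, Metric.mem_ball_self (half_pos hη)⟩⟩
      have hdis : Disjoint (W ∩ Metric.ball x (η / 2)) (O K) := disjoint_left.2 fun z hz hzK ↦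
        (hex K hK).subset ⟨hz.1, hzK⟩
      exact ⟨Or.inr hdis, hfix K hK _ hdis hd⟩
  · refine fun K hK ↦ ⟨O K, h K, (hO.1 K hK).1, (hKO K hK).1, fun x hx ↦ ?_, (hh K hK).1,
      fun L hL hLK ↦ disjoint_left.2 fun z hz hzK ↦
        hLK (hO.eq_of_mem hL hK ((hKO L hL).1 hz) hzK), (hh K hK).2, fun W hW ↦ hW.2.2 K hK⟩
    have := (hKO K hK).2 hx
    simpa only [mem_iUnion, Metric.mem_ball, exists_prop] using this

lemma exists_refines (h𝒦 : IsTameFamily 𝒦) (hnt : ∀ K ∈ 𝒦, ¬ K.Subsingleton)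
    (s : PieceStage 𝒦 C) {η : ℝ} (hη : 0 < η) : ∃ t : PieceStage 𝒦 C, s.Refines t η := by
  obtain ⟨𝒲, h𝒲, hmono, hdense, hdist, hshr⟩ := s.exists_allowed_shrink h𝒦 hη
  have hGc := s.discrete.isClosed_sUnion
  obtain ⟨Z, hZ, hZsep, hZmax⟩ := exists_maximal_separated (⋃₀ s.pieces)ᶜ η
  have hne : ∀ K ∈ 𝒦, K.Nonempty := fun K hK ↦ by
    rw [nonempty_iff_ne_empty]
    rintro rfl
    exact hnt _ hK subsingleton_empty
  have hpick : ∀ z : Z, ∃ K ∈ 𝒦, ∃ W ∈ 𝒲, K ⊆ W ∧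
      W ⊆ Metric.ball (z : X) (η / 4) ∩ (⋃₀ s.pieces)ᶜ := by
    intro z
    obtain ⟨W, hW, hWz, hWne⟩ := hdense (Metric.ball (z : X) (η / 4) ∩ (⋃₀ s.pieces)ᶜ)
      (Metric.isOpen_ball.inter hGc.isOpen_compl)
      ⟨z, Metric.mem_ball_self (by positivity), hZ z.2⟩
    obtain ⟨K, hK, hKW⟩ := h𝒦.2.2.2.2 W (s.isOpen_allowed W (h𝒲 hW)) hWne
    exact ⟨K, hK, W, hW, hKW, hWz⟩
  choose K hK W hW hKW hWz using hpick
  have hKz : ∀ (z : Z), ∀ x ∈ K z, dist x z < η / 4 ∧ x ∉ ⋃₀ s.pieces := fun z x hx ↦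
    ⟨Metric.mem_ball.1 (hWz z (hKW z hx)).1, (hWz z (hKW z hx)).2⟩
  have hclose : ∀ z z' : Z, dist (z : X) z' < η → z = z' := by
    intro z z' hzz
    by_contra hcon
    exact (hZsep z.2 z'.2 (fun h ↦ hcon (Subtype.ext h))).not_gt hzz
  have hnew : DiscreteOn univ (range K) := by
    intro x _
    have hx : Metric.ball x (η / 8) ∈ 𝓝 x := Metric.ball_mem_nhds x (by positivity)
    by_cases hex : ∃ z, (K z ∩ Metric.ball x (η / 8)).Nonempty ∧ x ∉ K z
    · obtain ⟨z, ⟨a, ha, hax⟩, hxz⟩ := hex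
      refine ⟨Metric.ball x (η / 8) ∩ (K z)ᶜ, Filter.inter_mem hx
        ((h𝒦.1 _ (hK z)).isClosed.isOpen_compl.mem_nhds hxz), ?_⟩
      rintro _ ⟨z', rfl⟩ ⟨b, hb, hbx, hbz⟩
      have : z = z' := by
        apply hclose
        rw [Metric.mem_ball] at hax hbx
        have h1 := (hKz z a ha).1
        have h2 := (hKz z' b hb).1
        have h3 := dist_triangle4_right (z : X) z' a b
        have h4 := dist_triangle_right a b x
        rw [dist_comm (z : X) a, dist_comm (z' : X) b] at h3
        linarith
      exact absurd (this ▸ hb) hbz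
    · push Not at hex
      refine ⟨_, hx, ?_⟩
      rintro _ ⟨z, rfl⟩ hne
      exact hex z hne
  have hold : ∀ A ∈ s.pieces, ∀ z, Disjoint A (K z) := fun A hA z ↦
    disjoint_left.2 fun x hxA hxz ↦ (hKz z x hxz).2 ⟨A, hA, hxA⟩
  refine ⟨⟨s.pieces ∪ range K, 𝒲, ?_, ?_, s.discrete.union hnew, ?_,
    fun W hW ↦ s.isOpen_allowed W (h𝒲 hW), fun W hW ↦ s.disjoint_allowed W (h𝒲 hW), hmono,
    hdense⟩, subset_union_left, h𝒲, ?_, hdist, ?_, hshr⟩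
  · rintro _ (hA | ⟨z, rfl⟩)
    · exact s.pieces_subset hA
    · exact hK z
  · rintro A (hA | ⟨z, rfl⟩) B (hB | ⟨z', rfl⟩) hAB
    · exact s.disjoint A hA B hB hAB
    · exact hold A hA z'
    · exact (hold B hB z).symm
    · refine disjoint_left.2 fun x hx hx' ↦ hAB (congrArg K (hclose z z' ?_))
      linarith [dist_triangle_left (z : X) z' x, (hKz z x hx).1, (hKz z' x hx').1]
  · rintro A (hA | ⟨z, rfl⟩)
    · exact s.disjoint_set A hA
    · exact (s.disjoint_allowed _ (h𝒲 (hW z))).mono_left (hKW z)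
  · rintro A (hA | ⟨z, rfl⟩) hAs
    · exact absurd hA hAs
    · exact ⟨W z, hW z, hKW z⟩
  · intro x
    by_cases hx : x ∈ ⋃₀ s.pieces
    · obtain ⟨A, hA, hxA⟩ := hx
      exact ⟨A, Or.inl hA, x, hxA, by rw [dist_self]; positivity⟩
    · obtain ⟨z, hz, hxz⟩ : ∃ z ∈ Z, dist x z < η := by
        by_cases hxZ : x ∈ Z
        · exact ⟨x, hxZ, by rwa [dist_self]⟩
        · exact hZmax x hx hxZ
      obtain ⟨y, hy⟩ := hne _ (hK ⟨z, hz⟩)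
      have hyz := (hKz ⟨z, hz⟩ y hy).1
      refine ⟨_, Or.inr ⟨⟨z, hz⟩, rfl⟩, y, hy, ?_⟩
      linarith [dist_triangle_right x y z]

end PieceStage

namespace PieceStage

variable {X : Type*} [MetricSpace X] {𝒦 : Set (Set X)} {C : Set X} {s : ℕ → PieceStage 𝒦 C}

lemma pieces_monotone (hs : ∀ n, (s n).Refines (s (n + 1)) ((1 / 2) ^ n)) :
    Monotone fun n ↦ (s n).pieces := monotone_nat_of_le_succ fun n ↦ (hs n).pieces_subset

lemma exists_allowed_of_notMem (hs : ∀ n, (s n).Refines (s (n + 1)) ((1 / 2) ^ n)) {m n : ℕ}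
    {K : Set X} (hK : K ∈ (s m).pieces) (hKn : K ∉ (s n).pieces) :
    ∃ W ∈ (s (n + 1)).allowed, K ⊆ W := by
  have hanti : Antitone fun n ↦ (s n).allowed :=
    antitone_nat_of_succ_le fun n ↦ (hs n).allowed_subset
  induction m with
  | zero => exact absurd (pieces_monotone hs n.zero_le hK) hKn
  | succ m ih =>
    by_cases hKm : K ∈ (s m).pieces
    · exact ih hKm
    · obtain ⟨W, hW, hKW⟩ := (hs m).exists_of_new K hK hKm
      refine ⟨W, hanti (Nat.succ_le_succ ?_) hW, hKW⟩
      by_contra! hmn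
      exact hKn (pieces_monotone hs hmn hK)

lemma exists_decomposition (hs : ∀ n, (s n).Refines (s (n + 1)) ((1 / 2) ^ n))
    (hcpt : ∀ K ∈ 𝒦, IsCompact K) (hnt : ∀ K ∈ 𝒦, ¬ K.Subsingleton) :
    ∃ D : Decomposition X, ∀ A, A ∈ D.nontrivialPieces ↔ ∃ n, A ∈ (s n).pieces := by
  have hdisj : ∀ {m n : ℕ} {A B : Set X}, A ∈ (s m).pieces → B ∈ (s n).pieces → A ≠ B →
      Disjoint A B := fun {m n} _ _ hA hB ↦ (s (max m n)).disjoint _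
    (pieces_monotone hs (le_max_left m n) hA) _ (pieces_monotone hs (le_max_right m n) hB)
  refine ⟨⟨{A | (∃ n, A ∈ (s n).pieces) ∨ ∃ x, A = {x} ∧ ∀ n, ∀ B ∈ (s n).pieces, x ∉ B},
    ?_, ?_, ?_, fun x ↦ ?_⟩, fun A ↦ ⟨?_, fun h ↦ ⟨Or.inl h, ?_⟩⟩⟩
  · rintro A (⟨n, hA⟩ | ⟨x, rfl, -⟩)
    · rw [nonempty_iff_ne_empty]
      rintro rfl
      exact hnt _ ((s n).pieces_subset hA) subsingleton_empty
    · exact singleton_nonempty x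
  · rintro A (⟨n, hA⟩ | ⟨x, rfl, -⟩)
    · exact hcpt A ((s n).pieces_subset hA)
    · exact isCompact_singleton
  · rintro A (⟨m, hA⟩ | ⟨x, rfl, hx⟩) B (⟨n, hB⟩ | ⟨y, rfl, hy⟩) hAB
    · exact hdisj hA hB hAB
    · exact disjoint_singleton_right.2 (hy m A hA)
    · exact disjoint_singleton_left.2 (hx n B hB)
    · exact disjoint_singleton.2 fun hxy ↦ hAB (hxy ▸ rfl)
  · by_cases hx : ∃ n, ∃ B ∈ (s n).pieces, x ∈ B
    · obtain ⟨n, B, hB, hxB⟩ := hx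
      exact ⟨B, Or.inl ⟨n, hB⟩, hxB⟩
    · push Not at hx
      exact ⟨{x}, Or.inr ⟨x, rfl, hx⟩, mem_singleton x⟩
  · rintro ⟨hA | ⟨x, rfl, -⟩, hns⟩
    · exact hA
    · exact absurd subsingleton_singleton hns
  · obtain ⟨n, hA⟩ := h
    exact hnt A ((s n).pieces_subset hA)

lemma dist_le_of_notMem (hs : ∀ n, (s n).Refines (s (n + 1)) ((1 / 2) ^ n)) {D : Decomposition X}
    (hD : ∀ A, A ∈ D.nontrivialPieces ↔ ∃ n, A ∈ (s n).pieces)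
    {n : ℕ} {K : Set X} (hK : K ∈ D.pieces) (hKn : K ∉ (s n).pieces)
    {x y : X} (hx : x ∈ K) (hy : y ∈ K) : dist x y ≤ (1 / 2) ^ n := by
  by_cases hKs : K.Subsingleton
  · rw [hKs hx hy, dist_self]
    positivity
  · obtain ⟨m, hKm⟩ := (hD K).1 ⟨hK, hKs⟩
    obtain ⟨W, hW, hKW⟩ := exists_allowed_of_notMem hs hKm hKn
    exact (hs n).dist_le W hW x (hKW hx) y (hKW hy)

lemma vanishing (hs : ∀ n, (s n).Refines (s (n + 1)) ((1 / 2) ^ n)) {D : Decomposition X}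
    (hD : ∀ A, A ∈ D.nontrivialPieces ↔ ∃ n, A ∈ (s n).pieces) : D.Vanishing := by
  intro 𝒰 h𝒰 hcov x
  obtain ⟨u, hu, hxu⟩ : x ∈ ⋃₀ 𝒰 := hcov ▸ mem_univ x
  obtain ⟨ρ, hρ, hball⟩ := Metric.isOpen_iff.1 (h𝒰 u hu) x hxu
  obtain ⟨n, hn⟩ := exists_pow_lt_of_lt_one (half_pos hρ) (by norm_num : (1 / 2 : ℝ) < 1)
  obtain ⟨V, hV, hVA⟩ := (s n).discrete x (mem_univ x)
  have key : ∀ A ∈ D.pieces, (∀ u ∈ 𝒰, ¬ A ⊆ u) → ((V ∩ Metric.ball x (ρ / 2)) ∩ A).Nonempty →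
      x ∈ A := by
    rintro A hA hAu ⟨y, ⟨hyV, hyx⟩, hyA⟩
    refine hVA A (by_contra fun hAn ↦ hAu u hu fun z hz ↦ hball ?_) ⟨y, hyA, hyV⟩
    have := dist_le_of_notMem hs hD hA hAn hz hyA
    rw [Metric.mem_ball] at hyx ⊢
    linarith [dist_triangle z y x]
  exact ⟨_, Filter.inter_mem hV (Metric.ball_mem_nhds x (half_pos hρ)), fun A hA hAu B hB hBu hVA
    hVB ↦ D.eq_of_mem hA hB (key A hA hAu hVA) (key B hB hBu hVB)⟩

lemma stronglyShrinkable (hs : ∀ n, (s n).Refines (s (n + 1)) ((1 / 2) ^ n)) {D : Decomposition X}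
    (hD : ∀ A, A ∈ D.nontrivialPieces ↔ ∃ n, A ∈ (s n).pieces) : D.StronglyShrinkable := by
  refine (vanishing hs hD).stronglyShrinkable fun K hK δ hδ ↦ ?_
  obtain ⟨m, hKm⟩ := (hD K).1 hK
  obtain ⟨k, hk⟩ := exists_pow_lt_of_lt_one hδ (by norm_num : (1 / 2 : ℝ) < 1)
  obtain ⟨n, hmn, hkn⟩ : ∃ n, m ≤ n ∧ k ≤ n := ⟨max m k, le_max_left m k, le_max_right m k⟩
  have hn : (1 / 2 : ℝ) ^ n < δ :=
    (pow_le_pow_of_le_one (by norm_num) (by norm_num) hkn).trans_lt hk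
  obtain ⟨O, h, hO, hKO, hOK, hh, hLO, hhK, hW⟩ :=
    (hs n).exists_shrink K (pieces_monotone hs hmn hKm)
  refine ⟨O, h, hO, ?_, hKO, fun x hx ↦ ?_, hh, fun L hL hLO' x hx y hy ↦ ?_⟩
  · rintro L hL ⟨x, hxL, hxO⟩
    by_cases hLs : L.Subsingleton
    · exact fun y hy ↦ hLs hxL hy ▸ hxO
    obtain ⟨l, hLl⟩ := (hD L).1 ⟨hL, hLs⟩
    by_cases hLn : L ∈ (s n).pieces
    · rcases eq_or_ne L K with rfl | hLK
      · exact hKO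
      · exact absurd hxO ((hLO L hLn hLK).notMem_of_mem_left hxL)
    · obtain ⟨W, hW', hLW⟩ := exists_allowed_of_notMem hs hLl hLn
      rcases (hW W hW').1 with hWO | hWO
      · exact hLW.trans hWO
      · exact absurd hxO (hWO.notMem_of_mem_left (hLW hxL))
  · obtain ⟨k, hk, hxk⟩ := hOK x hx
    exact ⟨k, hk, hxk.trans hn⟩
  · by_cases hLs : L.Subsingleton
    · rw [hLs hx hy, dist_self]
      exact hδ.le
    obtain ⟨l, hLl⟩ := (hD L).1 ⟨hL, hLs⟩
    refine le_trans ?_ hn.le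
    by_cases hLn : L ∈ (s n).pieces
    · rcases eq_or_ne L K with rfl | hLK
      · exact hhK x hx y hy
      · exact absurd (hLO' hx) ((hLO L hLn hLK).notMem_of_mem_left hx)
    · obtain ⟨W, hW', hLW⟩ := exists_allowed_of_notMem hs hLl hLn
      exact (hW W hW').2 x (hLW hx) y (hLW hy)

lemma isDenseDecomp (hs : ∀ n, (s n).Refines (s (n + 1)) ((1 / 2) ^ n)) {D : Decomposition X}
    (hD : ∀ A, A ∈ D.nontrivialPieces ↔ ∃ n, A ∈ (s n).pieces) : D.IsDenseDecomp := by
  have hq : Continuous D.q := continuous_coinduced_rng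
  refine dense_iff_inter_open.2 fun U hU ⟨A, hA⟩ ↦ ?_
  obtain ⟨x, hx⟩ := D.nonempty' A.1 A.2
  have hxU : x ∈ D.q ⁻¹' U := by
    have : D.q x = A := Subtype.ext (D.eq_of_mem (D.q x).2 A.2 (D.mem_q x) hx)
    rwa [mem_preimage, this]
  obtain ⟨ρ, hρ, hball⟩ := Metric.isOpen_iff.1 (hU.preimage hq) x hxU
  obtain ⟨n, hn⟩ := exists_pow_lt_of_lt_one (half_pos hρ) (by norm_num : (1 / 2 : ℝ) < 1)
  obtain ⟨K, hK, y, hy, hxy⟩ := (hs n).dense x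
  have hKD := (hD K).2 ⟨_, hK⟩
  refine ⟨D.q y, hball ?_, ?_⟩
  · rw [Metric.mem_ball, dist_comm]
    linarith
  · change ¬ (D.q y).1.Subsingleton
    rw [D.eq_of_mem (D.q y).2 hKD.1 (D.mem_q y) hy]
    exact hKD.2

end PieceStage

lemma IsTameFamily.exists_isKSpongy {X : Type*} [MetricSpace X] {𝒦 : Set (Set X)}
    (h𝒦 : IsTameFamily 𝒦) (hnt : ∀ K ∈ 𝒦, ¬ K.Subsingleton) {A : Set X}
    (hA : IsNowhereDense A) : ∃ S, IsKSpongy 𝒦 S ∧ A ⊆ S := by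
  let s₀ : PieceStage 𝒦 (closure A) :=
    { pieces := ∅
      allowed := {W | IsOpen W ∧ Disjoint W (closure A)}
      pieces_subset := empty_subset _
      disjoint := fun _ h ↦ h.elim
      discrete := fun x _ ↦ ⟨univ, Filter.univ_mem, fun _ h ↦ h.elim⟩
      disjoint_set := fun _ h ↦ h.elim
      isOpen_allowed := fun _ h ↦ h.1
      disjoint_allowed := fun _ h ↦ h.2
      allowed_mono := fun _ h _ hW' ho ↦ ⟨ho, h.2.mono_left hW'⟩
      exists_allowed := fun U hU hne ↦ ⟨U \ closure A,
        ⟨hU.sdiff isClosed_closure, disjoint_sdiff_left⟩, sdiff_subset, by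
          rw [nonempty_iff_ne_empty, Ne, sdiff_eq_empty]
          intro hUA
          exact hne.ne_empty (subset_empty_iff.1 ((interior_maximal hUA hU).trans
            (Eq.subset hA)))⟩ }
  have hex : ∀ (s : PieceStage 𝒦 (closure A)) (n : ℕ), ∃ t, s.Refines t ((1 / 2) ^ n) :=
    fun s n ↦ s.exists_refines h𝒦 hnt (by positivity)
  choose next hnext using hex
  let s : ℕ → PieceStage 𝒦 (closure A) := fun n ↦ Nat.rec s₀ (fun n t ↦ next t n) n
  have hs : ∀ n, (s n).Refines (s (n + 1)) ((1 / 2) ^ n) := fun n ↦ hnext (s n) n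
  obtain ⟨D, hD⟩ := PieceStage.exists_decomposition hs h𝒦.1 hnt
  refine ⟨(⋃ K ∈ D.pieces, interior K)ᶜ, ⟨D, ⟨PieceStage.vanishing hs hD,
    PieceStage.stronglyShrinkable hs hD, fun K hK hKs ↦ ?_⟩, PieceStage.isDenseDecomp hs hD,
    compl_compl _⟩, fun x hx hxK ↦ ?_⟩
  · obtain ⟨n, hn⟩ := (hD K).1 ⟨hK, hKs⟩
    exact (s n).pieces_subset hn
  · obtain ⟨K, hK, hxK⟩ := (h𝒦.mem_iUnion_interior hnt).1 hxK
    obtain ⟨n, hn⟩ := (hD K).1 hK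
    exact ((s n).disjoint_set K hn).notMem_of_mem_left (interior_subset hxK) (subset_closure hx)

/-- A completely metrizable space admits a bounded complete metric. -/
lemma CompletelyMetrizable.exists_bounded {X : Type*} [t : TopologicalSpace X]
    (h : CompletelyMetrizable X) : ∃ m : MetricSpace X, m.toUniformSpace.toTopologicalSpace = t ∧
      @CompleteSpace X m.toUniformSpace ∧ ∀ x y, m.dist x y ≤ 1 := by
  obtain ⟨m, rfl, hc⟩ := h
  let m' : MetricSpace X :=
    { dist := fun x y ↦ min (dist x y) 1
      dist_self := fun x ↦ by simp
      dist_comm := fun x y ↦ by simp only [dist_comm]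
      dist_triangle := fun x y z ↦ by
        have h₁ := dist_triangle x y z
        have h₂ := dist_nonneg (x := x) (y := y)
        have h₃ := dist_nonneg (x := y) (y := z)
        rcases min_cases (dist x y) 1 with h | h <;> rcases min_cases (dist y z) 1 with h' | h' <;>
          rw [h.1, h'.1, min_le_iff]
        · exact Or.inl h₁
        all_goals exact Or.inr (by linarith)
      eq_of_dist_eq_zero := fun {x y} h ↦ by
        rcases min_choice (dist x y) 1 with h' | h'
        · exact dist_eq_zero.1 (h'.symm.trans h)
        · exact absurd (h'.symm.trans h) one_ne_zero
      toUniformSpace := m.toUniformSpace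
      uniformity_dist := by
        rw [Metric.uniformity_basis_dist.eq_biInf]
        refine le_antisymm (le_iInf₂ fun ε hε ↦ ?_) (le_iInf₂ fun ε hε ↦ ?_)
        · exact iInf₂_le_of_le ε hε (Filter.principal_mono.2
            fun p (hp : dist p.1 p.2 < ε) ↦ show min (dist p.1 p.2) 1 < ε from min_lt_of_left_lt hp)
        · refine iInf₂_le_of_le (min ε 1) (lt_min hε one_pos)
            (Filter.principal_mono.2 fun p (hp : min (dist p.1 p.2) 1 < min ε 1) ↦ ?_)
          rcases min_cases (dist p.1 p.2) 1 with h | h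
          · exact (h.1.symm.trans_lt hp).trans_le (min_le_left _ _)
          · exact absurd ((h.1.symm.trans_lt hp).trans_le (min_le_right _ _)) (lt_irrefl _) }
  exact ⟨m', rfl, hc, fun x y ↦ min_le_right _ _⟩

/-- Theorem: existence, ambient uniqueness and universality of `𝒦`-spongy sets. -/
theorem KSpongy_main (X : Type*) [TopologicalSpace X]
    (hX : CompletelyMetrizable X) (hslh : StronglyLocallyHomogeneous X)
    (𝒦 : Set (Set X)) (h𝒦 : IsTameFamily 𝒦)
    (hnt : ∀ K ∈ 𝒦, ¬ K.Subsingleton) (hint : ∀ K ∈ 𝒦, (interior K).Nonempty) :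
    (∀ A : Set X, IsNowhereDense A → ∃ S : Set X, IsKSpongy 𝒦 S ∧ A ⊆ S) ∧
    (∀ S S' : Set X, IsKSpongy 𝒦 S → IsKSpongy 𝒦 S' → ∃ h : X ≃ₜ X, ⇑h '' S = S') ∧
    (∀ S : Set X, IsKSpongy 𝒦 S → UniversalNowhereDense S) := by
  obtain ⟨m, rfl, hc, hbdd⟩ := hX.exists_bounded
  have hex : ∀ A : Set X, IsNowhereDense A → ∃ S : Set X, IsKSpongy 𝒦 S ∧ A ⊆ S :=
    fun A hA ↦ h𝒦.exists_isKSpongy hnt hA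
  have huniq : ∀ S S' : Set X, IsKSpongy 𝒦 S → IsKSpongy 𝒦 S' → ∃ h : X ≃ₜ X, ⇑h '' S = S' :=
    fun S S' hS hS' ↦ IsKSpongy.exists_homeomorph hbdd h𝒦 hnt hS hS'
  refine ⟨hex, huniq, fun S hS ↦ ⟨IsKSpongy.isNowhereDense hint hS, fun A hA ↦ ?_⟩⟩
  obtain ⟨S₀, hS₀, hAS₀⟩ := hex A hA
  obtain ⟨h, rfl⟩ := huniq S₀ S hS₀ hS
  exact ⟨h, image_mono hAS₀⟩

end
end

section
/- Let X be a strongly locally homogeneous completely metrizable space and let K be an ambiently invariant family of locally shrinkable compact subsets of X possessing the local shift property. Then the following conditions are equivalent: (1) ⋃K = X; (2) ⋃K is dense in X; (3) each nonempty open set U ⊆ X contains a set K ∈ K; (4) for each point x ∈ X and each open neighborhood U ⊆ X of x there is a set K ∈ K with x ∈ K ⊆ U. -/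
open Set Topology unitInterval

noncomputable section

/-- A locally shrinkable set is nonempty: the empty cover of the empty set has no members. -/
theorem LocallyShrinkable.nonempty {X : Type*} [TopologicalSpace X] {K : Set X}
    (h : LocallyShrinkable K) : K.Nonempty := by
  by_contra hK
  rw [not_nonempty_iff_eq_empty] at hK
  obtain ⟨-, -, v, hv, -⟩ :=
    h ∅ isOpen_empty hK.subset ∅ (fun v hv => absurd hv (notMem_empty v)) (empty_subset _)
  exact notMem_empty v hv

/-- In a strongly locally homogeneous space, the union of the homeomorphic copies of any set
has open complement. -/
theorem StronglyLocallyHomogeneous.isOpen_forall_homeomorph_notMem {X : Type*}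
    [TopologicalSpace X] (hX : StronglyLocallyHomogeneous X) (U : Set X) :
    IsOpen {z : X | ∀ h : X ≃ₜ X, h z ∉ U} := by
  rw [isOpen_iff_mem_nhds]
  intro z hz
  obtain ⟨N, hN, -, hNh⟩ := hX z univ Filter.univ_mem
  filter_upwards [hN] with y hy g hg
  obtain ⟨h, rfl, -⟩ := hNh y hy
  exact hz (h.trans g) hg

/-- In a strongly locally homogeneous space, a locally shrinkable set meeting an open set `U`
can be moved into `U` by a homeomorphism of the space. -/
theorem LocallyShrinkable.exists_homeomorph_image_subset {X : Type*} [TopologicalSpace X]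
    (hX : StronglyLocallyHomogeneous X) {K U : Set X} (hK : LocallyShrinkable K)
    (hU : IsOpen U) (hKU : (K ∩ U).Nonempty) : ∃ h : X ≃ₜ X, ⇑h '' K ⊆ U := by
  obtain ⟨x, hxK, hxU⟩ := hKU
  obtain ⟨g, -, v, hv, hgv⟩ := hK univ isOpen_univ (subset_univ K)
    (insert {z | ∀ h : X ≃ₜ X, h z ∉ U} (range fun h : X ≃ₜ X => h ⁻¹' U))
    (by
      rintro v (rfl | ⟨h, rfl⟩)
      · exact ⟨hX.isOpen_forall_homeomorph_notMem U, subset_univ _⟩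
      · exact ⟨hU.preimage h.continuous, subset_univ _⟩)
    (by
      intro z _
      by_cases hz : ∀ h : X ≃ₜ X, h z ∉ U
      · exact ⟨_, mem_insert _ _, hz⟩
      · push Not at hz
        obtain ⟨h, hh⟩ := hz
        exact ⟨_, mem_insert_of_mem _ (mem_range_self h), hh⟩)
  rcases hv with rfl | ⟨h, rfl⟩
  · have hx := hgv (mem_image_of_mem g hxK) g.symm
    rw [g.symm_apply_apply] at hx
    exact absurd hxU hx
  · refine ⟨g.trans h, ?_⟩
    rintro _ ⟨y, hy, rfl⟩
    exact hgv (mem_image_of_mem g hy)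

/-- Proposition: equivalent density conditions for an ambiently invariant family of
locally shrinkable compact sets with the local shift property in a strongly locally
homogeneous completely metrizable space. -/
theorem tame_family_density_tfae (X : Type*) [TopologicalSpace X]
    (hX : CompletelyMetrizable X) (hslh : StronglyLocallyHomogeneous X)
    (𝒦 : Set (Set X)) (hc : ∀ K ∈ 𝒦, IsCompact K) (hai : AmbientlyInvariant 𝒦)
    (hls : ∀ K ∈ 𝒦, LocallyShrinkable K) (hshift : LocalShiftProperty 𝒦) :
    List.TFAE [⋃₀ 𝒦 = Set.univ,
      Dense (⋃₀ 𝒦),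
      ∀ U : Set X, IsOpen U → U.Nonempty → ∃ K ∈ 𝒦, K ⊆ U,
      ∀ x : X, ∀ U : Set X, IsOpen U → x ∈ U → ∃ K ∈ 𝒦, x ∈ K ∧ K ⊆ U] := by
  tfae_have 1 → 2 := fun h => h ▸ dense_univ
  tfae_have 2 → 3 := by
    intro h U hU hne
    obtain ⟨x, hxU, K, hK, hxK⟩ := h.inter_open_nonempty U hU hne
    obtain ⟨g, hg⟩ := (hls K hK).exists_homeomorph_image_subset hslh hU ⟨x, hxK, hxU⟩
    exact ⟨_, hai g K hK, hg⟩
  tfae_have 3 → 4 := by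
    intro h x U hU hx
    obtain ⟨N, hN, hNU, hNh⟩ := hslh x U (hU.mem_nhds hx)
    obtain ⟨K, hK, hKN⟩ := h (interior N) isOpen_interior ⟨x, mem_interior_iff_mem_nhds.2 hN⟩
    obtain ⟨y, hy⟩ := (hls K hK).nonempty
    obtain ⟨g, rfl, hg⟩ := hNh y (interior_subset (hKN hy))
    refine ⟨_, hai g.symm K hK, ⟨g x, hy, g.symm_apply_apply x⟩, ?_⟩
    rintro _ ⟨z, hz, rfl⟩
    by_contra hzU
    have hfix := hg _ hzU
    rw [g.apply_symm_apply] at hfix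
    exact hzU (hfix ▸ hNU (interior_subset (hKN hz)))
  tfae_have 4 → 1 := by
    intro h
    refine eq_univ_of_forall fun x => ?_
    obtain ⟨K, hK, hxK, -⟩ := h x univ isOpen_univ (mem_univ x)
    exact ⟨K, hK, hxK⟩
  tfae_finish

end
end
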